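/- arXiv:2008.01223 — 2 statements merged into one kernel-verified Lean document; each statement's English description precedes it below -/
import Mathlib

section
/- For every α ∈ (0,1) there exist constants c > 0 and C > 0 such that the following holds. Let q be a prime power, n ≥ 1, let 𝝁 be an n×n matrix of α-balanced measures on F_q, and let M ~ M(𝝁). Then for every integer k with 0 ≤ k ≤ n: |P(the first k rows of M are linearly independent) − ∏_{i=n−k+1}^∞ (1 − q^{−i})| ≤ C e^{−cαn}. -/
/- STATEMENT 11: For every α ∈ (0,1) there are c, C > 0 such that for 𝝁 an n×n matrix
of α-balanced measures on F_q, M ~ M(𝝁) and 0 ≤ k ≤ n,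
|P(first k rows of M linearly independent) − ∏_{i=n−k+1}^∞ (1 − q^{−i})| ≤ C e^{−cαn}. -/

open scoped Classical

noncomputable section

/-- `μ` is an `α`-balanced probability measure on the finite additive group `F`. -/
def IsBalanced {F : Type*} [AddCommGroup F] [Fintype F] (α : ℝ) (μ : F → ℝ) : Prop :=
  (∀ x, 0 ≤ μ x) ∧ (∑ x, μ x = 1) ∧
    ∀ (x : F) (H : AddSubgroup F), H ≠ ⊤ →
      ∑ y ∈ Finset.univ.filter (fun y => y - x ∈ H), μ y ≤ 1 - α

/-- The probability of an event `E` for a random matrix with independent entries. -/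
def matProb {F : Type*} [Fintype F] {n : ℕ} (μ : Fin n → Fin n → F → ℝ)
    (E : Set (Matrix (Fin n) (Fin n) F)) : ℝ :=
  ∑ M ∈ Finset.univ.filter (fun M : Matrix (Fin n) (Fin n) F => M ∈ E),
    ∏ i, ∏ j, μ i j (M i j)

/-- The product weight on a finite product. -/
def pw {ι Ω : Type*} [Fintype ι] (w : ι → Ω → ℝ) (x : ι → Ω) : ℝ := ∏ i, w i (x i)

/-- The total weight of the points satisfying a predicate. -/
def pr {Ω : Type*} [Fintype Ω] (w : Ω → ℝ) (E : Ω → Prop) : ℝ := ∑ x, if E x then w x else 0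

/-- `w` is a probability weight. -/
def IsProb {Ω : Type*} [Fintype Ω] (w : Ω → ℝ) : Prop := (∀ x, 0 ≤ w x) ∧ ∑ x, w x = 1

lemma pw_nonneg {ι Ω : Type*} [Fintype ι] {w : ι → Ω → ℝ} (hw : ∀ i x, 0 ≤ w i x)
    (x : ι → Ω) : 0 ≤ pw w x :=
  Finset.prod_nonneg fun i _ => hw i _

section Weights

variable {ι κ Ω : Type*} [Fintype ι] [Fintype κ] [Fintype Ω] [DecidableEq ι] [DecidableEq κ]

lemma sum_pw (w : ι → Ω → ℝ) : ∑ x, pw w x = ∏ i, ∑ a, w i a := by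
  simp only [pw]
  rw [Finset.prod_univ_sum, Fintype.piFinset_univ]

lemma IsProb.pw {w : ι → Ω → ℝ} (hw : ∀ i, IsProb (w i)) : IsProb (pw w) :=
  ⟨pw_nonneg fun i => (hw i).1, by rw [sum_pw]; exact Finset.prod_eq_one fun i _ => (hw i).2⟩

lemma pr_nonneg {w : Ω → ℝ} (hw : ∀ x, 0 ≤ w x) (E : Ω → Prop) : 0 ≤ pr w E :=
  Finset.sum_nonneg fun x _ => by split_ifs <;> simp [hw]

lemma pr_mono {w : Ω → ℝ} (hw : ∀ x, 0 ≤ w x) {E E' : Ω → Prop} (h : ∀ x, E x → E' x) :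
    pr w E ≤ pr w E' :=
  Finset.sum_le_sum fun x _ => by
    by_cases hE : E x
    · simp [hE, h x hE]
    · simp only [hE, if_false]; split_ifs <;> simp [hw]

lemma pr_le_one {w : Ω → ℝ} (hw : IsProb w) (E : Ω → Prop) : pr w E ≤ 1 := by
  rw [← hw.2]
  exact Finset.sum_le_sum fun x _ => by split_ifs <;> simp [hw.1]

lemma pr_or_le {w : Ω → ℝ} (hw : ∀ x, 0 ≤ w x) (E E' : Ω → Prop) :
    pr w (fun x => E x ∨ E' x) ≤ pr w E + pr w E' := by
  unfold pr
  rw [← Finset.sum_add_distrib]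
  refine Finset.sum_le_sum fun x _ => ?_
  have := hw x
  by_cases h1 : E x <;> by_cases h2 : E' x <;> simp [h1, h2, this]

lemma pr_exists_le {w : Ω → ℝ} (hw : ∀ x, 0 ≤ w x) {A : Type*} (s : Finset A)
    (E : A → Ω → Prop) : pr w (fun x => ∃ a ∈ s, E a x) ≤ ∑ a ∈ s, pr w (E a) := by
  unfold pr
  rw [Finset.sum_comm]
  refine Finset.sum_le_sum fun x _ => ?_
  split_ifs with h
  · obtain ⟨a, ha, hE⟩ := h
    have := Finset.single_le_sum (f := fun a => if E a x then w x else 0)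
      (fun b _ => by split_ifs <;> simp [hw]) ha
    simpa [hE] using this
  · exact Finset.sum_nonneg fun b _ => by split_ifs <;> simp [hw]

lemma pr_compl {w : Ω → ℝ} (hw : IsProb w) (E : Ω → Prop) :
    pr w E = 1 - pr w (fun x => ¬ E x) := by
  rw [← hw.2, eq_sub_iff_add_eq]
  unfold pr
  rw [← Finset.sum_add_distrib]
  refine Finset.sum_congr rfl fun x _ => ?_
  by_cases h : E x <;> simp [h]

/-- Resampling one coordinate. -/
lemma resample (w : ι → Ω → ℝ) (i : ι) (G : (ι → Ω) → ℝ) :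
    (∑ a, w i a) * ∑ x, pw w x * G x =
      ∑ x, pw w x * ∑ a, w i a * G (Function.update x i a) := by
  have hp : ∀ (a : Ω) (y : {j // j ≠ i} → Ω),
      pw w ((Equiv.funSplitAt i Ω).symm (a, y)) = w i a * ∏ j, w j.1 (y j) := by
    intro a y
    unfold pw
    rw [Fintype.prod_eq_mul_prod_subtype_ne _ i]
    congr 1
    · simp
    · exact Finset.prod_congr rfl fun j _ => by simp [j.2]
  have hu : ∀ (a b : Ω) (y : {j // j ≠ i} → Ω),
      Function.update ((Equiv.funSplitAt i Ω).symm (b, y)) i a =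
        (Equiv.funSplitAt i Ω).symm (a, y) := by
    intro a b y
    ext j
    by_cases h : j = i
    · subst h; simp
    · simp [Function.update, h]
  have hs : ∀ f : (ι → Ω) → ℝ,
      ∑ x, f x = ∑ a, ∑ y, f ((Equiv.funSplitAt i Ω).symm (a, y)) := by
    intro f
    rw [← Fintype.sum_prod_type', Equiv.sum_comp]
  rw [hs, hs, Finset.sum_mul]
  refine Finset.sum_congr rfl fun b _ => ?_
  simp only [hp, hu, Finset.mul_sum]
  rw [Finset.sum_comm]
  refine Finset.sum_congr rfl fun y _ => Finset.sum_congr rfl fun a _ => by ring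

/-- A bound for an event conditionally on all coordinates but one. -/
lemma pr_le_of_resample {w : ι → Ω → ℝ} (hw : ∀ i, IsProb (w i)) (i : ι)
    (E : (ι → Ω) → Prop) (b : ℝ)
    (h : ∀ x, pr (w i) (fun a => E (Function.update x i a)) ≤ b) : pr (pw w) E ≤ b := by
  have := resample w i (fun x => if E x then 1 else 0)
  rw [(hw i).2, one_mul] at this
  have h2 : pr (pw w) E = ∑ x, pw w x * if E x then 1 else 0 := by simp [pr]
  rw [h2, this]
  calc _ ≤ ∑ x, pw w x * b := by
        refine Finset.sum_le_sum fun x _ => ?_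
        refine mul_le_mul_of_nonneg_left ?_ (pw_nonneg (fun i => (hw i).1) x)
        simpa [pr] using h x
    _ = b := by rw [← Finset.sum_mul, (IsProb.pw hw).2, one_mul]

/-- Marginals of a product weight. -/
lemma pr_comp_of_injective {w : ι → Ω → ℝ} (hw : ∀ i, IsProb (w i)) (e : κ → ι)
    (he : Function.Injective e) (E : (κ → Ω) → Prop) :
    pr (pw w) (fun x => E (x ∘ e)) = pr (pw (fun k => w (e k))) E := by
  unfold pr
  have : ∀ x : ι → Ω, (if E (x ∘ e) then pw w x else 0) =
      ∑ y : κ → Ω, if x ∘ e = y then (if E y then pw w x else 0) else 0 := by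
    intro x; simp
  simp_rw [this]
  rw [Finset.sum_comm]
  refine Finset.sum_congr rfl fun y _ => ?_
  by_cases hE : E y
  · simp only [hE, if_true]
    rw [← Finset.sum_filter]
    have hset : (Finset.univ.filter fun x : ι → Ω => x ∘ e = y) =
        Fintype.piFinset (fun i => Finset.univ.filter fun a => ∀ k, e k = i → a = y k) := by
      ext x
      simp only [Finset.mem_filter, Finset.mem_univ, true_and, Fintype.mem_piFinset]
      constructor
      · rintro h i k rfl; exact congrFun h k
      · intro h; ext k; exact h _ k rfl
    unfold pw
    rw [hset, ← Finset.prod_univ_sum]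
    rw [← Finset.prod_subset (Finset.subset_univ (Finset.univ.image e)),
      Finset.prod_image (fun a _ b _ h => he h)]
    · refine Finset.prod_congr rfl fun k _ => ?_
      have : (Finset.univ.filter fun a => ∀ k', e k' = e k → a = y k') = {y k} := by
        ext a
        simp only [Finset.mem_filter, Finset.mem_univ, true_and, Finset.mem_singleton]
        exact ⟨fun h => h k rfl, fun h k' hk => by rw [h, he hk]⟩
      rw [this, Finset.sum_singleton]
    · intro i _ hi
      have : (Finset.univ.filter fun a => ∀ k', e k' = i → a = y k') = Finset.univ := by
        ext a
        simp only [Finset.mem_filter, Finset.mem_univ, true_and, iff_true]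
        intro k hk
        exact absurd (Finset.mem_image.2 ⟨k, Finset.mem_univ _, hk⟩) hi
      rw [this, (hw i).2]
  · simp [hE]

/-- Splitting off the last coordinate. -/
lemma sum_pw_snoc {k : ℕ} (w : Fin (k + 1) → Ω → ℝ) (G : (Fin (k + 1) → Ω) → ℝ) :
    ∑ x, pw w x * G x = ∑ x : Fin k → Ω, ∑ a,
      pw (fun i => w i.castSucc) x * w (Fin.last k) a * G (Fin.snoc x a) := by
  rw [← (Fin.snocEquiv (fun _ => Ω)).sum_comp, Fintype.sum_prod_type, Finset.sum_comm]
  refine Finset.sum_congr rfl fun x _ => Finset.sum_congr rfl fun a _ => ?_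
  simp [pw, Fin.prod_univ_castSucc, Fin.snocEquiv]

/-- Factorising over a set of coordinates. -/
lemma sum_pw_split (w : ι → Ω → ℝ) (I : Finset ι) (E : Ω → Prop)
    (K : ({i // i ∉ I} → Ω) → ℝ) :
    ∑ x, pw w x * ((if ∀ i ∈ I, E (x i) then 1 else 0) * K (fun i => x i.1)) =
      (∏ i ∈ I, pr (w i) E) * ∑ y, pw (fun i : {i // i ∉ I} => w i.1) y * K y := by
  rw [← (Equiv.piEquivPiSubtypeProd (fun i => i ∈ I) (fun _ => Ω)).symm.sum_comp,
    Fintype.sum_prod_type]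
  have h1 : (∏ i ∈ I, pr (w i) E) =
      ∑ z : {i // i ∈ I} → Ω, ∏ i, (if E (z i) then w i.1 (z i) else 0) := by
    rw [← Finset.prod_coe_sort]
    unfold pr
    rw [Finset.prod_univ_sum, Fintype.piFinset_univ]
  rw [h1, Finset.sum_mul_sum]
  refine Finset.sum_congr rfl fun z _ => Finset.sum_congr rfl fun y _ => ?_
  have h2 : pw w ((Equiv.piEquivPiSubtypeProd (fun i => i ∈ I) (fun _ => Ω)).symm (z, y)) =
      (∏ i, w i.1 (z i)) * pw (fun i : {i // i ∉ I} => w i.1) y := by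
    unfold pw
    rw [← Fintype.prod_subtype_mul_prod_subtype (fun i => i ∈ I)]
    congr 1
    · exact Finset.prod_congr (by ext; simp) fun i _ => by simp [i.2]
    · exact Finset.prod_congr (by ext; simp) fun i _ => by simp [i.2]
  have h3 : (fun i : {i // i ∉ I} =>
      (Equiv.piEquivPiSubtypeProd (fun i => i ∈ I) (fun _ => Ω)).symm (z, y) i.1) = y := by
    ext i; simp [i.2]
  have h4 : (∀ i ∈ I, E ((Equiv.piEquivPiSubtypeProd (fun i => i ∈ I)
      (fun _ => Ω)).symm (z, y) i)) ↔ ∀ i, E (z i) := by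
    constructor
    · rintro h ⟨i, hi⟩; simpa [hi] using h i hi
    · intro h i hi; simpa [hi] using h ⟨i, hi⟩
  rw [h2, h3]
  simp only [h4]
  by_cases h : ∀ i, E (z i)
  · simp [h]; ring
  · simp only [h, if_false, zero_mul, mul_zero]
    push Not at h
    obtain ⟨i, hi⟩ := h
    rw [Finset.prod_eq_zero (Finset.mem_univ i) (by simp [hi]), zero_mul]

end Weights

section LinearAlgebra

variable {F : Type*} [Field F]

lemma exists_determining_coords {ι : Type*} [Fintype ι] (d : ℕ) :
    ∀ W : Submodule F (ι → F), Module.finrank F W = d →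
      ∃ S : Finset ι, S.card ≤ d ∧ ∀ x ∈ W, (∀ j ∈ S, x j = 0) → x = 0 := by
  induction d using Nat.strong_induction_on with
  | _ d ih =>
    intro W hW
    by_cases hbot : W = ⊥
    · exact ⟨∅, by simp, fun x hx _ => by simpa [hbot] using hx⟩
    · obtain ⟨x, hxW, hx0⟩ := Submodule.exists_mem_ne_zero_of_ne_bot hbot
      obtain ⟨j, hj⟩ := Function.ne_iff.1 hx0
      set W' := W ⊓ LinearMap.ker (LinearMap.proj (R := F) (φ := fun _ : ι => F) j) with hW'
      have hlt : W' < W := by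
        refine lt_of_le_of_ne inf_le_left fun h => hj ?_
        have : x ∈ W' := h ▸ hxW
        simpa using this.2
      have hfr := Submodule.finrank_lt_finrank_of_lt hlt
      obtain ⟨S, hS, hS'⟩ := ih _ (hW ▸ hfr) W' rfl
      refine ⟨insert j S, (Finset.card_insert_le _ _).trans (by omega), fun y hy h => ?_⟩
      refine hS' y ⟨hy, ?_⟩ fun i hi => h i (Finset.mem_insert_of_mem hi)
      simpa using h j (Finset.mem_insert_self _ _)

/-- Odlyzko's bound: a vector with independent spread-out coordinates lies in a fixed subspace
with probability exponentially small in the codimension. -/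
lemma pr_mem_submodule_le [Fintype F] {ι : Type*} [Fintype ι] [DecidableEq ι] {μ : ι → F → ℝ}
    (hμ : ∀ i, IsProb (μ i)) {b : ℝ} (hb0 : 0 ≤ b) (hb1 : b ≤ 1) (hb : ∀ i a, μ i a ≤ b)
    (W : Submodule F (ι → F)) :
    pr (pw μ) (fun x => x ∈ W) ≤ b ^ (Fintype.card ι - Module.finrank F W) := by
  obtain ⟨S, hS, hinj⟩ := exists_determining_coords _ W rfl
  have hpt : ∀ x, pw μ x ≤ b ^ (Fintype.card ι - Module.finrank F W) *
      pw (fun i : {i // i ∈ S} => μ i.1) (fun i => x i.1) := by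
    intro x
    unfold pw
    rw [Finset.prod_coe_sort S (fun i => μ i (x i)), ← Finset.prod_sdiff (Finset.subset_univ S)]
    refine mul_le_mul_of_nonneg_right ?_ (Finset.prod_nonneg fun i _ => (hμ i).1 _)
    calc ∏ i ∈ Finset.univ \ S, μ i (x i) ≤ ∏ i ∈ Finset.univ \ S, b :=
          Finset.prod_le_prod (fun i _ => (hμ i).1 _) fun i _ => hb i _
      _ = b ^ (Fintype.card ι - S.card) := by
          rw [Finset.prod_const, ← Finset.compl_eq_univ_sdiff, Finset.card_compl]
      _ ≤ _ := pow_le_pow_of_le_one hb0 hb1 (by omega)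
  calc pr (pw μ) (fun x => x ∈ W)
      = ∑ x ∈ Finset.univ.filter (fun x => x ∈ W), pw μ x := by
        unfold pr; rw [Finset.sum_filter]
    _ ≤ ∑ x ∈ Finset.univ.filter (fun x => x ∈ W), b ^ (Fintype.card ι - Module.finrank F W) *
      pw (fun i : {i // i ∈ S} => μ i.1) (fun i => x i.1) := Finset.sum_le_sum fun x _ => hpt x
    _ ≤ b ^ (Fintype.card ι - Module.finrank F W) * 1 := by
        rw [← Finset.mul_sum]
        refine mul_le_mul_of_nonneg_left ?_ (pow_nonneg hb0 _)
        rw [← (IsProb.pw fun i : {i // i ∈ S} => hμ i.1).2]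
        rw [← Finset.sum_image (s := Finset.univ.filter (fun x => x ∈ W))
          (g := fun (x : ι → F) (i : {i // i ∈ S}) => x i.1)
          (f := pw (fun i : {i // i ∈ S} => μ i.1))]
        · exact Finset.sum_le_sum_of_subset_of_nonneg (Finset.subset_univ _)
            fun y _ _ => pw_nonneg (fun i => (hμ _).1) y
        · intro x hx y hy hxy
          simp only [Finset.coe_filter, Finset.mem_univ, true_and, Set.mem_ofPred_eq] at hx hy
          refine sub_eq_zero.1 (hinj _ (W.sub_mem hx hy) fun j hj => ?_)
          simpa [sub_eq_zero] using congrFun hxy ⟨j, hj⟩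
    _ = _ := mul_one _

/-- Steinitz exchange inside a basis. -/
lemma exists_exchange {E : Type*} [AddCommGroup E] [Module F E] [Module.Finite F E] {k r : ℕ}
    {X : Fin k → E} {Y : Fin r → E} {V : Submodule F E} (hV : Module.finrank F V = k)
    (hX : LinearIndependent F X) (hXV : ∀ i, X i ∈ V) (hY : LinearIndependent F Y)
    (hYV : ∀ i, Y i ∈ V) :
    ∃ I : Finset (Fin k), I.card = r ∧
      LinearIndependent F (Sum.elim Y (fun i : {i // i ∉ I} => X i.1)) := by
  set v : Fin r ⊕ Fin k → E := Sum.elim Y X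
  have hs : LinearIndepOn F v (Set.range Sum.inl) := by
    rw [LinearIndepOn, ← linearIndependent_equiv (Equiv.ofInjective _ Sum.inl_injective)]
    exact hY
  obtain ⟨b, -, hsb, hspan, hb⟩ := exists_linearIndepOn_extension hs (Set.subset_univ _)
  refine ⟨Finset.univ.filter fun i => Sum.inr i ∉ b, ?_, ?_⟩
  · have hsX : Submodule.span F (Set.range X) = V := by
      refine Submodule.eq_of_le_of_finrank_eq ?_ ?_
      · rw [Submodule.span_le]; rintro _ ⟨i, rfl⟩; exact hXV i
      · rw [finrank_span_eq_card hX, hV, Fintype.card_fin]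
    have hsb' : Submodule.span F (v '' b) = V := by
      refine le_antisymm ?_ ?_
      · rw [Submodule.span_le]
        rintro _ ⟨(i | i), -, rfl⟩
        · exact hYV i
        · exact hXV i
      · rw [← hsX, Submodule.span_le]
        rintro _ ⟨i, rfl⟩
        exact hspan ⟨Sum.inr i, Set.mem_univ _, rfl⟩
    have hcard : b.toFinset.card = k := by
      have h := finrank_span_eq_card hb
      rw [← Set.toFinset_card] at h
      rw [Set.image_eq_range] at hsb'
      rw [← h, hsb', hV]
    have h2 : b.toFinset = (Finset.univ.map ⟨Sum.inl, Sum.inl_injective⟩) ∪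
        ((Finset.univ.filter fun i => Sum.inr i ∈ b).map ⟨Sum.inr, Sum.inr_injective⟩) := by
      ext (i | i)
      · have : Sum.inl i ∈ b := hsb ⟨i, rfl⟩
        simp [this]
      · simp
    rw [h2, Finset.card_union_of_disjoint, Finset.card_map, Finset.card_map] at hcard
    · have := Finset.card_filter_add_card_filter_not (s := (Finset.univ : Finset (Fin k)))
        (fun i => Sum.inr i ∈ b)
      simp only [Finset.card_univ, Fintype.card_fin] at this hcard
      omega
    · rw [Finset.disjoint_left]
      simp
  · have hg : ∀ z : Fin r ⊕ {i // i ∉ Finset.univ.filter fun i : Fin k => Sum.inr i ∉ b},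
        (Sum.map id Subtype.val z : Fin r ⊕ Fin k) ∈ b := by
      rintro (i | i)
      · exact hsb ⟨i, rfl⟩
      · have := i.2
        simpa using this
    have := hb.comp (fun z => (⟨Sum.map id Subtype.val z, hg z⟩ : b)) (by
      intro z z' h
      have h' := congrArg Subtype.val h
      exact (Sum.map_injective.2 ⟨Function.injective_id, Subtype.val_injective⟩) h')
    convert this using 1
    ext (i | i) <;> rfl

end LinearAlgebra

/-- The law of a random matrix is invariant under transposition. -/
lemma pr_transpose {ι κ F : Type*} [Fintype ι] [Fintype κ] [DecidableEq ι] [DecidableEq κ] [Fintype F] (μ : ι → κ → F → ℝ)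
    (E : (ι → κ → F) → Prop) :
    pr (pw fun i => pw (μ i)) E =
      pr (pw fun j => pw fun i => μ i j) (fun Y => E fun i j => Y j i) := by
  unfold pr
  rw [← (Equiv.piComm (fun (_ : ι) (_ : κ) => F)).symm.sum_comp]
  refine Finset.sum_congr rfl fun Y _ => ?_
  have : pw (fun i => pw (μ i)) ((Equiv.piComm (fun (_ : ι) (_ : κ) => F)).symm Y) =
      pw (fun j => pw fun i => μ i j) Y := by
    unfold pw
    rw [Finset.prod_comm]
    rfl
  rw [this]
  rfl

/-- The support of a vector. -/
def supp {ι F : Type*} [Fintype ι] [Zero F] (v : ι → F) : Finset ι :=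
  Finset.univ.filter fun j => v j ≠ 0

/-- A random matrix is unlikely to have a sparse kernel vector. -/
lemma pr_sparse_le {ι κ F : Type*} [Fintype ι] [Fintype κ] [DecidableEq ι] [DecidableEq κ] [Field F] [Fintype F]
    {μ : κ → ι → F → ℝ} (hμ : ∀ i j, IsProb (μ i j)) {b : ℝ} (hb0 : 0 ≤ b) (hb1 : b ≤ 1)
    (hb : ∀ i j a, μ i j a ≤ b) (s : ℕ) :
    pr (pw fun i => pw (μ i)) (fun X => ∃ v : ι → F, v ≠ 0 ∧ (supp v).card ≤ s ∧
      ∀ i, v ⬝ᵥ X i = 0) ≤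
      (Finset.univ.filter fun S : Finset ι => S.card ≤ s).card * Fintype.card ι *
        b ^ (Fintype.card κ - s) := by
  rw [pr_transpose]
  set w := pw fun j => pw fun i => μ i j
  have hw : IsProb w := IsProb.pw fun j => IsProb.pw fun i => hμ i j
  set T := (Finset.univ.filter fun S : Finset ι => S.card ≤ s) ×ˢ (Finset.univ : Finset ι)
  calc _ ≤ pr w (fun Y => ∃ p ∈ T, p.2 ∈ p.1 ∧
        Y p.2 ∈ Submodule.span F (Y '' (p.1.erase p.2 : Finset ι))) := by
        refine pr_mono hw.1 ?_
        rintro Y ⟨v, hv0, hv, hvY⟩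
        obtain ⟨j, hj⟩ := Function.ne_iff.1 hv0
        refine ⟨(supp v, j), by simp [T, hv], by simpa [supp] using hj, ?_⟩
        have h1 : Y j = ∑ l ∈ (supp v).erase j, (-(v j)⁻¹ * v l) • Y l := by
          have h2 : ∑ l, v l • Y l = 0 := by
            ext i
            have := hvY i
            simpa [dotProduct] using this
          have h3 : ∑ l ∈ supp v, v l • Y l = 0 := by
            rw [← h2]
            refine Finset.sum_subset (Finset.subset_univ _) fun l _ hl => ?_
            have : v l = 0 := by simpa [supp] using hl
            simp [this]
          rw [← Finset.add_sum_erase _ _ (show j ∈ supp v by simpa [supp] using hj)] at h3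
          have h4 : Y j = (-(v j)⁻¹) • ∑ l ∈ (supp v).erase j, v l • Y l := by
            rw [← neg_eq_iff_add_eq_zero.2 h3, smul_neg, neg_smul, neg_neg, smul_smul,
              inv_mul_cancel₀ hj, one_smul]
          rw [h4, Finset.smul_sum]
          simp [smul_smul]
        show Y j ∈ _
        rw [h1]
        exact Submodule.sum_mem _ fun l hl => Submodule.smul_mem _ _
          (Submodule.subset_span ⟨l, hl, rfl⟩)
    _ ≤ ∑ p ∈ T, pr w (fun Y => p.2 ∈ p.1 ∧
        Y p.2 ∈ Submodule.span F (Y '' (p.1.erase p.2 : Finset ι))) := pr_exists_le hw.1 _ _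
    _ ≤ ∑ p ∈ T, b ^ (Fintype.card κ - s) := by
        refine Finset.sum_le_sum fun p hp => ?_
        have hps : p.1.card ≤ s := by simpa [T] using hp
        refine pr_le_of_resample (fun j => IsProb.pw fun i => hμ i j) p.2 _ _ fun Y => ?_
        set W := Submodule.span F (Y '' (p.1.erase p.2 : Finset ι))
        by_cases hpp : p.2 ∈ p.1
        · calc _ ≤ pr (pw fun i => μ i p.2) (fun a => a ∈ W) := by
                refine pr_mono (IsProb.pw fun i => hμ i p.2).1 fun a ha => ?_
                have h5 := ha.2
                rw [Function.update_self] at h5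
                convert h5 using 2
                refine Set.image_congr fun l hl => ?_
                rw [Function.update_of_ne (Finset.ne_of_mem_erase hl)]
            _ ≤ b ^ (Fintype.card κ - Module.finrank F W) :=
                pr_mem_submodule_le (fun i => hμ i _) hb0 hb1 (fun i => hb i _) W
            _ ≤ _ := by
                refine pow_le_pow_of_le_one hb0 hb1 ?_
                have : Module.finrank F W ≤ (p.1.erase p.2).card := by
                  rw [show W = Submodule.span F (((p.1.erase p.2).image Y : Finset (κ → F)) :
                    Set (κ → F)) by rw [Finset.coe_image]]
                  exact (finrank_span_finset_le_card _).trans Finset.card_image_le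
                have := Finset.card_erase_le (s := p.1) (a := p.2)
                omega
        · simp [pr, hpp, hb0]
    _ = _ := by rw [Finset.sum_const, nsmul_eq_mul]; simp [T]

section Fourier

variable {F : Type*} [Field F] [Fintype F]

/-- The characteristic function of a weight on `F`. -/
def chf (ψ : AddChar F ℂ) (μ : F → ℝ) (ξ : F) : ℂ := ∑ a, (μ a : ℂ) * ψ (ξ * a)

/-- The defect `1 - ‖chf ψ μ ξ‖ ^ 2`, written as an average of a negative type kernel. -/
def defect (ψ : AddChar F ℂ) (μ : F → ℝ) (ξ : F) : ℝ :=
  ∑ a, ∑ b, μ a * μ b * (1 - (ψ (ξ * (a - b))).re)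

variable {ψ : AddChar F ℂ} {μ : F → ℝ}

lemma conj_addChar (ψ : AddChar F ℂ) (x : F) : (starRingEnd ℂ) (ψ x) = ψ (-x) := by
  rw [AddChar.map_neg_eq_inv, ← Complex.inv_eq_conj (ψ.norm_apply x)]

lemma chf_mul_conj (ψ : AddChar F ℂ) (μ : F → ℝ) (ξ : F) :
    chf ψ μ ξ * (starRingEnd ℂ) (chf ψ μ ξ) =
      ∑ a, ∑ b, (μ a : ℂ) * μ b * ψ (ξ * (a - b)) := by
  unfold chf
  rw [map_sum, Finset.sum_mul_sum]
  refine Finset.sum_congr rfl fun a _ => Finset.sum_congr rfl fun b _ => ?_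
  rw [map_mul (starRingEnd ℂ), conj_addChar, Complex.conj_ofReal, mul_sub, sub_eq_add_neg,
    AddChar.map_add_eq_mul ψ (ξ * a)]
  ring

lemma norm_chf_sq (hμ : IsProb μ) (ξ : F) : ‖chf ψ μ ξ‖ ^ 2 = 1 - defect ψ μ ξ := by
  have h1 : (‖chf ψ μ ξ‖ ^ 2 : ℝ) = (chf ψ μ ξ * (starRingEnd ℂ) (chf ψ μ ξ)).re := by
    rw [Complex.mul_conj, Complex.ofReal_re, Complex.normSq_eq_norm_sq]
  have h2 : (∑ a, ∑ b, μ a * μ b) = 1 := by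
    rw [← Finset.sum_mul_sum, hμ.2, one_mul]
  rw [h1, chf_mul_conj, ← h2]
  unfold defect
  simp only [Complex.re_sum, ← Finset.sum_sub_distrib]
  refine Finset.sum_congr rfl fun a _ => Finset.sum_congr rfl fun b _ => ?_
  rw [← Complex.ofReal_mul, Complex.re_ofReal_mul]
  ring

lemma defect_nonneg (hμ : ∀ a, 0 ≤ μ a) (ξ : F) : 0 ≤ defect ψ μ ξ :=
  Finset.sum_nonneg fun a _ => Finset.sum_nonneg fun b _ =>
    mul_nonneg (mul_nonneg (hμ a) (hμ b)) <| sub_nonneg.2 <|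
      (Complex.re_le_norm _).trans (ψ.norm_apply _).le

lemma defect_le_one (hμ : IsProb μ) (ξ : F) : defect ψ μ ξ ≤ 1 := by
  have := norm_chf_sq (ψ := ψ) hμ ξ
  nlinarith [sq_nonneg ‖chf ψ μ ξ‖]

lemma one_sub_re_mul_le {z w : ℂ} (hz : ‖z‖ = 1) (hw : ‖w‖ = 1) :
    1 - (z * w).re ≤ 2 * (1 - z.re) + 2 * (1 - w.re) := by
  have h : ∀ u : ℂ, ‖u‖ = 1 → ‖1 - u‖ ^ 2 = 2 * (1 - u.re) := by
    intro u hu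
    have h1 : u.re * u.re + u.im * u.im = 1 := by
      rw [← Complex.normSq_apply, Complex.normSq_eq_norm_sq, hu, one_pow]
    rw [← Complex.normSq_eq_norm_sq, Complex.normSq_apply]
    simp only [Complex.sub_re, Complex.one_re, Complex.sub_im, Complex.one_im]
    nlinarith
  have hzw : ‖z * w‖ = 1 := by rw [norm_mul, hz, hw, one_mul]
  have h1 : ‖1 - z * w‖ ≤ ‖1 - z‖ + ‖1 - w‖ := by
    calc ‖1 - z * w‖ = ‖(1 - z) + z * (1 - w)‖ := by ring_nf
      _ ≤ ‖1 - z‖ + ‖z * (1 - w)‖ := norm_add_le _ _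
      _ = _ := by rw [norm_mul, hz, one_mul]
  have h2 := h _ hz
  have h3 := h _ hw
  have h4 := h _ hzw
  nlinarith [norm_nonneg (1 - z * w), norm_nonneg (1 - z), norm_nonneg (1 - w),
    sq_nonneg (‖1 - z‖ - ‖1 - w‖)]

lemma defect_neg (ξ : F) : defect ψ μ (-ξ) = defect ψ μ ξ := by
  unfold defect
  refine Finset.sum_congr rfl fun a _ => Finset.sum_congr rfl fun b _ => ?_
  rw [neg_mul, ← conj_addChar, Complex.conj_re]

lemma defect_add_le (hμ : ∀ a, 0 ≤ μ a) (ξ η : F) :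
    defect ψ μ (ξ + η) ≤ 2 * defect ψ μ ξ + 2 * defect ψ μ η := by
  unfold defect
  simp only [Finset.mul_sum, ← Finset.sum_add_distrib]
  refine Finset.sum_le_sum fun a _ => Finset.sum_le_sum fun b _ => ?_
  have h := one_sub_re_mul_le (ψ.norm_apply (ξ * (a - b))) (ψ.norm_apply (η * (a - b)))
  rw [← AddChar.map_add_eq_mul, ← add_mul] at h
  nlinarith [mul_le_mul_of_nonneg_left h (mul_nonneg (hμ a) (hμ b))]

@[simp] lemma defect_zero : defect ψ μ 0 = 0 := by simp [defect]

lemma IsBalanced.isProb {α : ℝ} (h : IsBalanced α μ) : IsProb μ := ⟨h.1, h.2.1⟩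

lemma IsBalanced.le {α : ℝ} (h : IsBalanced α μ) (a : F) : μ a ≤ 1 - α := by
  have := h.2.2 a ⊥ bot_ne_top
  rw [Finset.sum_filter] at this
  simpa [sub_eq_zero] using this

/-- The average defect over a nontrivial group of frequencies is at least `α`. -/
lemma le_sum_defect (hψ : ψ.IsPrimitive) {α : ℝ} (hμ : IsBalanced α μ) {G : Type*}
    [AddCommGroup G] [Fintype G] (φ : G →+ F) (hφ : φ ≠ 0) :
    α * Fintype.card G ≤ ∑ g, defect ψ μ (φ g) := by
  set K : AddSubgroup F :=
    { carrier := {c | ∀ g, ψ (φ g * c) = 1}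
      zero_mem' := by simp
      add_mem' := by
        intro a b ha hb g
        rw [mul_add, AddChar.map_add_eq_mul, ha g, hb g, one_mul]
      neg_mem' := by
        intro a ha g
        rw [mul_neg, AddChar.map_neg_eq_inv, ha g, inv_one] } with hK
  have hmem : ∀ c, c ∈ K ↔ ∀ g, ψ (φ g * c) = 1 := fun c => Iff.rfl
  have hKtop : K ≠ ⊤ := by
    intro h
    obtain ⟨g, hg⟩ := DFunLike.ne_iff.1 hφ
    refine hψ (a := φ g) (by simpa using hg) ?_
    ext c
    have : c ∈ K := h ▸ AddSubgroup.mem_top c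
    simpa using (hmem c).1 this g
  have hsum : ∀ c, ∑ g, (1 - (ψ (φ g * c)).re) =
      Fintype.card G * (1 - if c ∈ K then 1 else 0) := by
    intro c
    have h1 := AddChar.sum_eq_ite ((AddChar.mulShift ψ c).compAddMonoidHom φ)
    have h2 : (AddChar.mulShift ψ c).compAddMonoidHom φ = 0 ↔ c ∈ K := by
      rw [hmem, DFunLike.ext_iff]
      simp [mul_comm]
    simp only [h2, AddChar.compAddMonoidHom_apply, AddChar.mulShift_apply] at h1
    rw [Finset.sum_sub_distrib, ← Complex.re_sum]
    simp_rw [mul_comm _ c]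
    rw [h1]
    split_ifs <;> simp
  have h3 : ∑ g, defect ψ μ (φ g) =
      ∑ b, μ b * ∑ a, μ a * (Fintype.card G * (1 - if a - b ∈ K then 1 else 0)) := by
    unfold defect
    simp only [Finset.mul_sum, ← hsum]
    rw [Finset.sum_comm]
    rw [Finset.sum_comm (s := (Finset.univ : Finset F)) (t := (Finset.univ : Finset F))]
    refine Finset.sum_congr rfl fun a _ => ?_
    rw [Finset.sum_comm]
    refine Finset.sum_congr rfl fun b _ => Finset.sum_congr rfl fun g _ => ?_
    ring
  have h4 : ∀ b, α * Fintype.card G ≤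
      ∑ a, μ a * (Fintype.card G * (1 - if a - b ∈ K then 1 else 0)) := by
    intro b
    have h5 := hμ.2.2 b K hKtop
    rw [Finset.sum_filter] at h5
    have h6 : ∑ a, μ a * ((Fintype.card G : ℝ) * (1 - if a - b ∈ K then 1 else 0)) =
        Fintype.card G * (∑ a, μ a - ∑ a, if a - b ∈ K then μ a else 0) := by
      rw [← Finset.sum_sub_distrib, Finset.mul_sum]
      refine Finset.sum_congr rfl fun a _ => ?_
      split_ifs <;> ring
    rw [h6, hμ.2.1]
    have : (0 : ℝ) ≤ Fintype.card G := Nat.cast_nonneg _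
    nlinarith
  rw [h3]
  calc α * Fintype.card G = ∑ b, μ b * (α * Fintype.card G) := by
        rw [← Finset.sum_mul, hμ.2.1, one_mul]
    _ ≤ _ := Finset.sum_le_sum fun b _ => mul_le_mul_of_nonneg_left (h4 b) (hμ.1 b)

/-- The lazy symmetrisation of a weight. -/
def lazy (β : ℝ) (μ : F → ℝ) (y : F) : ℝ :=
  (1 - β) * (if y = 0 then 1 else 0) + β * ∑ a, μ (a + y) * μ a

lemma isProb_lazy (hμ : IsProb μ) {β : ℝ} (h0 : 0 ≤ β) (h1 : β ≤ 1) : IsProb (lazy β μ) := by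
  constructor
  · intro y
    refine add_nonneg (mul_nonneg (by linarith) (by split_ifs <;> norm_num))
      (mul_nonneg h0 (Finset.sum_nonneg fun a _ => mul_nonneg (hμ.1 _) (hμ.1 _)))
  · unfold lazy
    rw [Finset.sum_add_distrib, ← Finset.mul_sum, ← Finset.mul_sum, Finset.sum_comm]
    have : ∀ a, ∑ y, μ (a + y) * μ a = μ a := by
      intro a
      rw [← Finset.sum_mul, Fintype.sum_equiv (Equiv.addLeft a) (fun y => μ (a + y)) μ
        (fun _ => rfl), hμ.2, one_mul]
    simp [this, hμ.2]

lemma lazy_le {α β : ℝ} (hμ : IsBalanced α μ) (h0 : 0 ≤ β) (h1 : β ≤ 1) (y : F) :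
    lazy β μ y ≤ 1 - α * β := by
  have h2 : ∑ a, μ (a + y) * μ a ≤ 1 - α := by
    calc _ ≤ ∑ a, (1 - α) * μ a :=
          Finset.sum_le_sum fun a _ => mul_le_mul_of_nonneg_right (hμ.le _) (hμ.1 a)
      _ = 1 - α := by rw [← Finset.mul_sum, hμ.2.1, mul_one]
  have h3 : (if y = 0 then (1 : ℝ) else 0) ≤ 1 := by split_ifs <;> norm_num
  unfold lazy
  nlinarith

lemma chf_lazy (hμ : IsProb μ) (β : ℝ) (ξ : F) :
    chf ψ (lazy β μ) ξ = ((1 - β * defect ψ μ ξ : ℝ) : ℂ) := by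
  have h1 : chf ψ (lazy β μ) ξ = (1 - β) + β * ∑ a, ∑ b, (μ a : ℂ) * μ b * ψ (ξ * (a - b)) := by
    unfold chf lazy
    push_cast
    simp only [add_mul, Finset.sum_add_distrib]
    congr 1
    · rw [Finset.sum_eq_single 0] <;> simp +contextual
    · simp only [Finset.mul_sum, Finset.sum_mul]
      rw [Finset.sum_comm, Finset.sum_comm (s := (Finset.univ : Finset F))
        (t := (Finset.univ : Finset F)) (f := fun a b => (β : ℂ) * (μ a * μ b * ψ (ξ * (a - b))))]
      refine Finset.sum_congr rfl fun a _ => Fintype.sum_equiv (Equiv.addLeft a) _ _ fun y => ?_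
      simp only [Equiv.coe_addLeft, add_sub_cancel_left]
      ring
  rw [h1, ← chf_mul_conj, Complex.mul_conj, Complex.normSq_eq_norm_sq, norm_chf_sq hμ]
  push_cast
  ring

end Fourier

section Perp

variable {F ι : Type*} [Field F] [Fintype ι]

/-- The orthogonal complement of a subspace with respect to the dot product. -/
def perp (V : Submodule F (ι → F)) : Submodule F (ι → F) :=
  LinearMap.BilinForm.orthogonal (dotProductBilin F F) V

lemma mem_perp {V : Submodule F (ι → F)} {v : ι → F} : v ∈ perp V ↔ ∀ x ∈ V, v ⬝ᵥ x = 0 := by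
  unfold perp
  rw [LinearMap.BilinForm.mem_orthogonal_iff]
  refine forall₂_congr fun x _ => ?_
  rw [dotProduct_comm]
  rfl

lemma isRefl_dotProduct :
    LinearMap.BilinForm.IsRefl (dotProductBilin F F : LinearMap.BilinForm F (ι → F)) := by
  intro x y h
  change y ⬝ᵥ x = 0
  rw [dotProduct_comm]
  exact h

lemma nondegenerate_dotProduct :
    LinearMap.BilinForm.Nondegenerate (dotProductBilin F F : LinearMap.BilinForm F (ι → F)) := by
  constructor
  · intro x h
    exact dotProduct_eq_zero x h
  · intro x h
    refine dotProduct_eq_zero x fun w => ?_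
    rw [dotProduct_comm]
    exact h w

lemma perp_perp (V : Submodule F (ι → F)) : perp (perp V) = V :=
  LinearMap.BilinForm.orthogonal_orthogonal nondegenerate_dotProduct isRefl_dotProduct V

lemma finrank_perp (V : Submodule F (ι → F)) :
    Module.finrank F (perp V) = Fintype.card ι - Module.finrank F V := by
  unfold perp
  rw [LinearMap.BilinForm.finrank_orthogonal nondegenerate_dotProduct,
    Module.finrank_fintype_fun_eq_card]

lemma card_perp [DecidableEq ι] [Fintype F] (V : Submodule F (ι → F)) :
    Fintype.card (perp V) = Fintype.card F ^ (Fintype.card ι - Module.finrank F V) := by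
  rw [Module.card_eq_pow_finrank (K := F), finrank_perp]

end Perp

section FourierInversion

variable {F ι : Type*} [Field F] [Fintype F] [Fintype ι] {ψ : AddChar F ℂ}

lemma sum_addChar_perp [DecidableEq ι] (hψ : ψ.IsPrimitive) (V : Submodule F (ι → F)) (x : ι → F) :
    ∑ v : perp V, ψ (v.1 ⬝ᵥ x) = if x ∈ V then (Fintype.card (perp V) : ℂ) else 0 := by
  set φ : perp V →+ F :=
    { toFun := fun v => v.1 ⬝ᵥ x
      map_zero' := by simp
      map_add' := by intro a b; simp [add_dotProduct] } with hφ
  have h1 := AddChar.sum_eq_ite (ψ.compAddMonoidHom φ)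
  have h2 : ψ.compAddMonoidHom φ = 0 ↔ x ∈ V := by
    rw [DFunLike.ext_iff]
    constructor
    · intro h
      rw [← perp_perp V, mem_perp]
      intro v hv
      by_contra hne
      rw [dotProduct_comm] at hne
      refine hψ hne ?_
      ext t
      have := h ⟨t • v, (perp V).smul_mem t hv⟩
      simpa [hφ, mul_comm] using this
    · intro hx v
      have := mem_perp.1 v.2 x hx
      simp [hφ, this]
  simp only [h2] at h1
  exact h1

lemma addChar_sum (ψ : AddChar F ℂ) (f : ι → F) : ψ (∑ i, f i) = ∏ i, ψ (f i) := by
  have := map_prod ψ.toMonoidHom (fun i => Multiplicative.ofAdd (f i)) Finset.univ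
  rw [← ofAdd_sum] at this
  exact this

/-- Fourier inversion for the probability that a product measure gives to a subspace. -/
lemma card_perp_mul_pr [DecidableEq ι] (hψ : ψ.IsPrimitive) (μ : ι → F → ℝ) (V : Submodule F (ι → F)) :
    (Fintype.card (perp V) : ℂ) * (pr (pw μ) (fun x => x ∈ V) : ℝ) =
      ∑ v : perp V, ∏ j, chf ψ (μ j) (v.1 j) := by
  have h1 : ∀ v : ι → F, ∏ j, chf ψ (μ j) (v j) = ∑ x, (pw μ x : ℂ) * ψ (v ⬝ᵥ x) := by
    intro v
    unfold chf
    rw [Fintype.prod_sum]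
    refine Finset.sum_congr rfl fun x _ => ?_
    rw [Finset.prod_mul_distrib, dotProduct, addChar_sum, pw]
    push_cast
    rfl
  simp only [h1]
  rw [Finset.sum_comm]
  simp only [← Finset.mul_sum, sum_addChar_perp hψ V]
  unfold pr
  push_cast
  rw [Finset.mul_sum]
  refine Finset.sum_congr rfl fun x _ => ?_
  split_ifs
  · ring
  · simp

lemma card_perp_pos [DecidableEq ι] (V : Submodule F (ι → F)) : (0 : ℝ) < Fintype.card (perp V) :=
  Nat.cast_pos.2 Fintype.card_pos

lemma abs_pr_sub_le [DecidableEq ι] (hψ : ψ.IsPrimitive) {μ : ι → F → ℝ} (hμ : ∀ j, IsProb (μ j))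
    (V : Submodule F (ι → F)) {θ : ℝ} (hθ : 0 ≤ θ)
    (h : ∀ v ∈ perp V, v ≠ 0 → ∏ j, ‖chf ψ (μ j) (v j)‖ ≤ θ) :
    |pr (pw μ) (fun x => x ∈ V) - (Fintype.card (perp V) : ℝ)⁻¹| ≤ θ := by
  have h1 := card_perp_mul_pr hψ μ V
  rw [← Finset.add_sum_erase _ _ (Finset.mem_univ (0 : perp V))] at h1
  have h0 : ∏ j, chf ψ (μ j) ((0 : perp V).1 j) = 1 := by
    refine Finset.prod_eq_one fun j _ => ?_
    have h3 : (∑ a, (μ j a : ℂ)) = 1 := by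
      rw [← Complex.ofReal_sum, (hμ j).2, Complex.ofReal_one]
    simp [chf, h3]
  rw [h0] at h1
  have hc := card_perp_pos V
  have h2 : ‖((Fintype.card (perp V) : ℝ) * pr (pw μ) (fun x => x ∈ V) - 1 : ℂ)‖ ≤
      Fintype.card (perp V) * θ := by
    have h4 : ((Fintype.card (perp V) : ℝ) * pr (pw μ) (fun x => x ∈ V) - 1 : ℂ) =
        ∑ v ∈ Finset.univ.erase (0 : perp V), ∏ j, chf ψ (μ j) (v.1 j) := by
      push_cast
      rw [h1]; ring
    rw [h4]
    refine (norm_sum_le _ _).trans ?_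
    calc _ ≤ ∑ v ∈ Finset.univ.erase (0 : perp V), θ := by
          refine Finset.sum_le_sum fun v hv => ?_
          rw [norm_prod]
          refine h v.1 v.2 fun h5 => ?_
          exact (Finset.mem_erase.1 hv).1 (Subtype.ext h5)
      _ ≤ ∑ v : perp V, θ := Finset.sum_le_sum_of_subset_of_nonneg (Finset.erase_subset _ _)
          fun _ _ _ => hθ
      _ = _ := by simp
  have h3 : |(Fintype.card (perp V) : ℝ) * pr (pw μ) (fun x => x ∈ V) - 1| ≤
      Fintype.card (perp V) * θ := by
    rw [← Real.norm_eq_abs, ← Complex.norm_real]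
    push_cast at h2 ⊢
    exact h2
  have h5 : pr (pw μ) (fun x => x ∈ V) - (Fintype.card (perp V) : ℝ)⁻¹ =
      (Fintype.card (perp V) : ℝ)⁻¹ * ((Fintype.card (perp V) : ℝ) * pr (pw μ) (fun x => x ∈ V) - 1)
      := by field_simp
  rw [h5, abs_mul, abs_of_pos (inv_pos.2 hc), inv_mul_le_iff₀ hc]
  exact h3

/-- The total defect of a frequency vector. -/
def height (ψ : AddChar F ℂ) (μ : ι → F → ℝ) (v : ι → F) : ℝ := ∑ j, defect ψ (μ j) (v j)

lemma prod_norm_chf_le {μ : ι → F → ℝ} (hμ : ∀ j, IsProb (μ j)) (v : ι → F) :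
    ∏ j, ‖chf ψ (μ j) (v j)‖ ≤ Real.exp (-(height ψ μ v / 2)) := by
  have h1 : Real.exp (-(height ψ μ v / 2)) = ∏ j, Real.exp (-(defect ψ (μ j) (v j) / 2)) := by
    rw [← Real.exp_sum]
    congr 1
    unfold height
    rw [Finset.sum_div, Finset.sum_neg_distrib]
  rw [h1]
  refine Finset.prod_le_prod (fun _ _ => norm_nonneg _) fun j _ => ?_
  refine abs_le_of_sq_le_sq' ?_ (Real.exp_pos _).le |>.2
  rw [norm_chf_sq (hμ j), ← Real.exp_nat_mul]
  have := Real.add_one_le_exp (-defect ψ (μ j) (v j))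
  calc _ ≤ _ := by linarith
    _ ≤ _ := this
    _ = _ := by congr 1; push_cast; ring

lemma card_perp_mul_pr_le [DecidableEq ι] (hψ : ψ.IsPrimitive) {μ : ι → F → ℝ} (hμ : ∀ j, IsProb (μ j))
    (V : Submodule F (ι → F)) :
    Fintype.card (perp V) * pr (pw μ) (fun x => x ∈ V) ≤
      ∑ v : perp V, Real.exp (-(height ψ μ v / 2)) := by
  have h1 := congrArg norm (card_perp_mul_pr hψ μ V)
  rw [norm_mul, Complex.norm_real, Complex.norm_natCast, Real.norm_of_nonneg
    (pr_nonneg (fun x => pw_nonneg (fun j => (hμ j).1) x) _)] at h1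
  rw [h1]
  refine (norm_sum_le _ _).trans (Finset.sum_le_sum fun v _ => ?_)
  rw [norm_prod]
  exact prod_norm_chf_le hμ v.1

lemma exp_neg_two_mul_le {x : ℝ} (h0 : 0 ≤ x) (h1 : x ≤ 1 / 2) : Real.exp (-(2 * x)) ≤ 1 - x := by
  have h2 : 1 + 2 * x ≤ Real.exp (2 * x) := by linarith [Real.add_one_le_exp (2 * x)]
  rw [Real.exp_neg, inv_le_comm₀ (Real.exp_pos _) (by linarith)]
  refine le_trans ?_ h2
  rw [inv_le_iff_one_le_mul₀ (by linarith)]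
  nlinarith

lemma le_card_perp_mul_pr_lazy [DecidableEq ι] (hψ : ψ.IsPrimitive) {μ : ι → F → ℝ} (hμ : ∀ j, IsProb (μ j))
    (V : Submodule F (ι → F)) {β : ℝ} (h0 : 0 ≤ β) (h1 : β ≤ 1 / 2) :
    ∑ v : perp V, Real.exp (-(2 * β * height ψ μ v)) ≤
      Fintype.card (perp V) * pr (pw fun j => lazy β (μ j)) (fun x => x ∈ V) := by
  have h2 := card_perp_mul_pr hψ (fun j => lazy β (μ j)) V
  simp only [chf_lazy (hμ _)] at h2
  have h3 : Fintype.card (perp V) * pr (pw fun j => lazy β (μ j)) (fun x => x ∈ V) =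
      ∑ v : perp V, ∏ j, (1 - β * defect ψ (μ j) (v.1 j)) := by
    apply Complex.ofReal_injective
    push_cast
    push_cast at h2
    exact h2
  rw [h3]
  refine Finset.sum_le_sum fun v _ => ?_
  have h4 : Real.exp (-(2 * β * height ψ μ v)) =
      ∏ j, Real.exp (-(2 * (β * defect ψ (μ j) (v.1 j)))) := by
    rw [← Real.exp_sum]
    congr 1
    unfold height
    rw [Finset.mul_sum, Finset.sum_neg_distrib]
    congr 1
    exact Finset.sum_congr rfl fun _ _ => by ring
  rw [h4]
  refine Finset.prod_le_prod (fun _ _ => (Real.exp_pos _).le) fun j _ => ?_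
  have h5 := defect_nonneg (ψ := ψ) (hμ j).1 (v.1 j)
  have h6 := defect_le_one (ψ := ψ) (hμ j) (v.1 j)
  refine exp_neg_two_mul_le (mul_nonneg h0 h5) ?_
  nlinarith

end FourierInversion

section Growth

open scoped Pointwise

variable {G : Type*} [AddCommGroup G] [Fintype G] {h : G → ℝ}

/-- The sublevel set of `h` at level `s`. -/
def sublevel (h : G → ℝ) (s : ℝ) : Finset G := Finset.univ.filter fun x => h x ≤ s

lemma card_sublevel_le (hneg : ∀ x, h (-x) = h x)
    (hadd : ∀ x y, h (x + y) ≤ 2 * h x + 2 * h y) {s : ℝ}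
    (htriv : ∀ H : AddSubgroup G, (∀ x ∈ H, h x ≤ 4 * s) → H = ⊥)
    (h0 : h 0 ≤ s) (hs : ∃ x ≠ 0, h x ≤ s) :
    ((sublevel h s).card : ℝ) ≤ 2 / 3 * (sublevel h (4 * s)).card := by
  by_contra! hlt
  set A : Finset (Multiplicative G) := Finset.univ.filter fun x => h x.toAdd ≤ s with hA
  have hAc : A.card = (sublevel h s).card :=
    Finset.card_bij (fun x _ => x.toAdd) (by simp [hA, sublevel]) (by simp)
      (fun b hb => ⟨Multiplicative.ofAdd b, by simpa [hA, sublevel] using hb, rfl⟩)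
  have hAA : (A * A).card ≤ (sublevel h (4 * s)).card := by
    refine Finset.card_le_card_of_injOn (fun x => x.toAdd) ?_ (by simp [Set.InjOn])
    intro x hx
    obtain ⟨a, ha, b, hb, rfl⟩ := Finset.mem_mul.1 hx
    simp only [hA, Finset.mem_filter, Finset.mem_univ, true_and] at ha hb
    have := hadd a.toAdd b.toAdd
    simp only [sublevel, Finset.coe_filter, Finset.mem_univ, true_and, Set.mem_ofPred_eq, toAdd_mul]
    linarith
  have hdoub : ((A * A).card : ℚ) < (3 / 2 : ℚ) * A.card := by
    rw [← Rat.cast_lt (K := ℝ)]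
    push_cast
    rw [hAc]
    have : ((A * A).card : ℝ) ≤ (sublevel h (4 * s)).card := by exact_mod_cast hAA
    linarith
  have hmem : ∀ x, x ∈ Finset.invMulSubgroup A hdoub ↔ x ∈ A⁻¹ * A := fun x => by
    rw [← SetLike.mem_coe, Finset.invMulSubgroup_eq_inv_mul, ← Finset.coe_mul, Finset.mem_coe]
  have hbot := htriv (Subgroup.toAddSubgroup' (Finset.invMulSubgroup A hdoub)) (by
    intro x hx
    have hx' : Multiplicative.ofAdd x ∈ A⁻¹ * A := (hmem _).1 hx
    obtain ⟨a, ha, b, hb, hab⟩ := Finset.mem_mul.1 hx'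
    have ha' : a⁻¹ ∈ A := Finset.mem_inv'.1 ha
    simp only [hA, Finset.mem_filter, Finset.mem_univ, true_and, toAdd_inv, hneg] at ha' hb
    have := hadd a.toAdd b.toAdd
    have hx2 : x = a.toAdd + b.toAdd := by rw [← toAdd_mul, hab]; rfl
    rw [hx2]
    linarith)
  obtain ⟨x, hx0, hxs⟩ := hs
  have hx : x ∈ Subgroup.toAddSubgroup' (Finset.invMulSubgroup A hdoub) := by
    change Multiplicative.ofAdd x ∈ Finset.invMulSubgroup A hdoub
    rw [hmem]
    refine Finset.mem_mul.2 ⟨1, ?_, Multiplicative.ofAdd x, ?_, one_mul _⟩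
    · rw [Finset.mem_inv']; simpa [hA] using h0
    · simpa [hA] using hxs
  rw [hbot] at hx
  exact hx0 (by simpa using hx)

lemma card_sublevel_le_pow (hneg : ∀ x, h (-x) = h x)
    (hadd : ∀ x y, h (x + y) ≤ 2 * h x + 2 * h y) (hzero : h 0 = 0) {S : ℝ}
    (htriv : ∀ H : AddSubgroup G, (∀ x ∈ H, h x ≤ S) → H = ⊥) (m : ℕ) {s : ℝ} (hs0 : 0 ≤ s)
    (hsS : 4 ^ m * s ≤ S) (hs : ∃ x ≠ 0, h x ≤ s) :
    ((sublevel h s).card : ℝ) ≤ (2 / 3) ^ m * (sublevel h (4 ^ m * s)).card := by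
  induction m generalizing s with
  | zero => simp
  | succ m ih =>
    have hpow : (1 : ℝ) ≤ 4 ^ m := one_le_pow₀ (by norm_num)
    have h1 : 4 * s ≤ S := by
      rw [pow_succ] at hsS
      nlinarith
    have h2 := card_sublevel_le hneg hadd (fun H hH => htriv H fun x hx => (hH x hx).trans h1)
      (by rw [hzero]; exact hs0) hs
    have h3 := ih (s := 4 * s) (by linarith) (by rw [← mul_assoc, ← pow_succ]; exact hsS)
      (by obtain ⟨x, hx, hxs⟩ := hs; exact ⟨x, hx, by linarith⟩)
    rw [← mul_assoc, ← pow_succ] at h3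
    calc _ ≤ _ := h2
      _ ≤ 2 / 3 * ((2 / 3) ^ m * (sublevel h (4 ^ (m + 1) * s)).card) := by gcongr
      _ = _ := by ring

lemma card_sublevel_le_one_add (hneg : ∀ x, h (-x) = h x)
    (hadd : ∀ x y, h (x + y) ≤ 2 * h x + 2 * h y) (hzero : h 0 = 0) {S : ℝ}
    (htriv : ∀ H : AddSubgroup G, (∀ x ∈ H, h x ≤ S) → H = ⊥) (m : ℕ) {s : ℝ} (hs0 : 0 ≤ s)
    (hsS : 4 ^ m * s ≤ S) :
    ((sublevel h s).card : ℝ) ≤ 1 + (2 / 3) ^ m * (sublevel h (4 ^ m * s)).card := by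
  by_cases hs : ∃ x ≠ 0, h x ≤ s
  · linarith [card_sublevel_le_pow hneg hadd hzero htriv m hs0 hsS hs]
  · push Not at hs
    have : sublevel h s ⊆ {0} := by
      intro x hx
      by_contra hne
      rw [Finset.mem_singleton] at hne
      exact absurd (Finset.mem_filter.1 hx).2 (not_le.2 (hs x hne))
    have h1 : ((sublevel h s).card : ℝ) ≤ 1 := by
      exact_mod_cast (Finset.card_le_card this).trans (by simp)
    have : (0 : ℝ) ≤ (2 / 3) ^ m * (sublevel h (4 ^ m * s)).card := by positivity
    linarith

end Growth

section LayerCake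

open MeasureTheory

lemma setIntegral_indicator_Iic {t : ℝ} (h0 : 0 ≤ t) (h1 : t ≤ 1) :
    ∫ x in Set.Ioc (0 : ℝ) 1, (Set.Iic t).indicator (fun _ => (1 : ℝ)) x = t := by
  rw [setIntegral_indicator measurableSet_Iic]
  have : Set.Ioc (0 : ℝ) 1 ∩ Set.Iic t = Set.Ioc 0 t := by
    ext x
    simp only [Set.mem_inter_iff, Set.mem_Ioc, Set.mem_Iic]
    exact ⟨fun h => ⟨h.1.1, h.2⟩, fun h => ⟨⟨h.1, h.2.trans h1⟩, h.2⟩⟩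
  rw [this]
  simp [h0]

lemma integrable_indicator_Iic (t : ℝ) :
    IntegrableOn ((Set.Iic t).indicator (fun _ => (1 : ℝ))) (Set.Ioc (0 : ℝ) 1) := by
  refine Integrable.indicator ?_ measurableSet_Iic
  exact integrableOn_const (by simp)

/-- Comparing two sums through the sizes of their superlevel sets. -/
lemma sum_le_of_card_le {U : Type*} [Fintype U] {f g : U → ℝ} (hf0 : ∀ u, 0 ≤ f u)
    (hf1 : ∀ u, f u ≤ 1) (hg0 : ∀ u, 0 ≤ g u) (hg1 : ∀ u, g u ≤ 1) {t ε : ℝ} (ht0 : 0 ≤ t)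
    (ht1 : t ≤ 1) (hε : 0 ≤ ε)
    (h : ∀ x, t < x → x ≤ 1 → ((Finset.univ.filter fun u => x ≤ f u).card : ℝ) ≤
      1 + ε * (Finset.univ.filter fun u => x ≤ g u).card) :
    ∑ u, f u ≤ Fintype.card U * t + 1 + ε * ∑ u, g u := by
  have hsum : ∀ k : U → ℝ, ∀ x, ∑ u, (Set.Iic (k u)).indicator (fun _ => (1 : ℝ)) x =
      (Finset.univ.filter fun u => x ≤ k u).card := by
    intro k x
    simp [Set.indicator_apply]
  have hInt : ∀ k : U → ℝ, IntegrableOn (fun x => ∑ u, (Set.Iic (k u)).indicator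
      (fun _ => (1 : ℝ)) x) (Set.Ioc (0 : ℝ) 1) := fun k =>
    integrable_finsetSum _ fun u _ => integrable_indicator_Iic (k u)
  have hval : ∀ k : U → ℝ, (∀ u, 0 ≤ k u) → (∀ u, k u ≤ 1) →
      ∫ x in Set.Ioc (0 : ℝ) 1, ∑ u, (Set.Iic (k u)).indicator (fun _ => (1 : ℝ)) x =
        ∑ u, k u := by
    intro k h0 h1
    rw [integral_finsetSum _ fun u _ => integrable_indicator_Iic (k u)]
    exact Finset.sum_congr rfl fun u _ => setIntegral_indicator_Iic (h0 u) (h1 u)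
  have hone : IntegrableOn (fun _ : ℝ => (1 : ℝ)) (Set.Ioc (0 : ℝ) 1) :=
    integrableOn_const (by simp)
  have hmono := setIntegral_mono_on (s := Set.Ioc (0 : ℝ) 1) (hInt f)
    ((((integrable_indicator_Iic t).const_mul (Fintype.card U : ℝ)).add hone).add
      ((hInt g).const_mul ε)) measurableSet_Ioc (fun x hx => by
      simp only [Pi.add_apply, hsum]
      have hnn : 0 ≤ ε * ((Finset.univ.filter fun u => x ≤ g u).card : ℝ) := by positivity
      by_cases hxt : x ≤ t
      · rw [Set.indicator_of_mem (Set.mem_Iic.2 hxt)]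
        have : ((Finset.univ.filter fun u => x ≤ f u).card : ℝ) ≤ Fintype.card U := by
          exact_mod_cast Finset.card_le_univ _
        linarith
      · rw [Set.indicator_of_notMem (by simpa using hxt)]
        have := h x (not_le.1 hxt) hx.2
        linarith)
  rw [hval f hf0 hf1] at hmono
  refine hmono.trans (le_of_eq ?_)
  have e1 := integral_add (μ := volume.restrict (Set.Ioc (0 : ℝ) 1))
    (((integrable_indicator_Iic t).const_mul (Fintype.card U : ℝ)).add hone)
      ((hInt g).const_mul ε)
  have e2 := integral_add (μ := volume.restrict (Set.Ioc (0 : ℝ) 1))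
    ((integrable_indicator_Iic t).const_mul (Fintype.card U : ℝ)) hone
  simp only [Pi.add_apply] at e1 e2 ⊢
  rw [e1, e2, integral_const_mul, integral_const_mul, hval g hg0 hg1,
    setIntegral_indicator_Iic ht0 ht1]
  simp

lemma sum_exp_le {G : Type*} [AddCommGroup G] [Fintype G] {h : G → ℝ} (hnn : ∀ x, 0 ≤ h x)
    (hneg : ∀ x, h (-x) = h x)
    (hadd : ∀ x y, h (x + y) ≤ 2 * h x + 2 * h y) (hzero : h 0 = 0) {S : ℝ}
    (htriv : ∀ H : AddSubgroup G, (∀ x ∈ H, h x ≤ S) → H = ⊥) (m : ℕ) {s : ℝ} (hs0 : 0 ≤ s)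
    (hsS : 4 ^ m * s ≤ S) :
    ∑ x, Real.exp (-(h x / 2)) ≤ Fintype.card G * Real.exp (-(s / 2)) + 1 +
      (2 / 3) ^ m * ∑ x, Real.exp (-(h x / (2 * 4 ^ m))) := by
  refine sum_le_of_card_le (fun _ => (Real.exp_pos _).le)
    (fun x => Real.exp_le_one_iff.2 (by linarith [hnn x])) (fun _ => (Real.exp_pos _).le)
    (fun x => Real.exp_le_one_iff.2 (neg_nonpos.2 (div_nonneg (hnn x) (by positivity))))
    (Real.exp_pos _).le (Real.exp_le_one_iff.2 (by linarith)) (by positivity) ?_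
  intro x hx hx1
  have hx0 : 0 < x := (Real.exp_pos _).trans hx
  set r := -2 * Real.log x with hr
  have hr0 : 0 ≤ r := by linarith [Real.log_nonpos hx0.le hx1]
  have hrs : r ≤ s := by
    have := (Real.lt_log_iff_exp_lt hx0).2 hx
    linarith
  have hK : (0 : ℝ) < 4 ^ m := by positivity
  have h1 := card_sublevel_le_one_add hneg hadd hzero htriv m hr0
    ((mul_le_mul_of_nonneg_left hrs hK.le).trans hsS)
  have e1 : (Finset.univ.filter fun u => x ≤ Real.exp (-(h u / 2))) = sublevel h r := by
    unfold sublevel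
    ext u
    simp only [Finset.mem_filter, Finset.mem_univ, true_and]
    rw [← Real.log_le_iff_le_exp hx0]
    constructor <;> intro h <;> linarith
  have e2 : (Finset.univ.filter fun u => x ≤ Real.exp (-(h u / (2 * 4 ^ m)))) =
      sublevel h (4 ^ m * r) := by
    unfold sublevel
    ext u
    simp only [Finset.mem_filter, Finset.mem_univ, true_and]
    rw [← Real.log_le_iff_le_exp hx0, le_neg, div_le_iff₀ (by positivity), hr]
    constructor <;> intro h <;> linarith
  rw [e1, e2]
  exact h1

end LayerCake

section Comparison

variable {F ι : Type*} [Field F] [Fintype F] [Fintype ι] {ψ : AddChar F ℂ}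

lemma height_neg (μ : ι → F → ℝ) (v : ι → F) : height ψ μ (-v) = height ψ μ v :=
  Finset.sum_congr rfl fun _ _ => defect_neg _

lemma height_zero (μ : ι → F → ℝ) : height ψ μ 0 = 0 := by simp [height]

lemma height_nonneg {μ : ι → F → ℝ} (hμ : ∀ j, IsProb (μ j)) (v : ι → F) : 0 ≤ height ψ μ v :=
  Finset.sum_nonneg fun j _ => defect_nonneg (hμ j).1 _

lemma height_add_le {μ : ι → F → ℝ} (hμ : ∀ j, IsProb (μ j)) (v w : ι → F) :
    height ψ μ (v + w) ≤ 2 * height ψ μ v + 2 * height ψ μ w := by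
  unfold height
  rw [Finset.mul_sum, Finset.mul_sum, ← Finset.sum_add_distrib]
  exact Finset.sum_le_sum fun j _ => defect_add_le (hμ j).1 _ _

/-- A nontrivial group of frequencies of small height contains only vectors of small support. -/
lemma mul_card_supp_le (hψ : ψ.IsPrimitive) {α : ℝ} {μ : ι → F → ℝ}
    (hμ : ∀ j, IsBalanced α (μ j)) {G : Type*} [AddCommGroup G] [Fintype G] (φ : G →+ (ι → F))
    {S : ℝ} (hS : ∀ g, height ψ μ (φ g) ≤ S) (g : G) : α * (supp (φ g)).card ≤ S := by
  have h1 : ∑ g, height ψ μ (φ g) ≤ S * Fintype.card G := by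
    calc _ ≤ ∑ _g : G, S := Finset.sum_le_sum fun g _ => hS g
      _ = _ := by simp [mul_comm]
  have h2 : (supp (φ g)).card * (α * Fintype.card G) ≤ ∑ g, height ψ μ (φ g) := by
    unfold height
    rw [Finset.sum_comm, ← nsmul_eq_mul, ← Finset.sum_const]
    calc _ ≤ ∑ j ∈ supp (φ g), ∑ x, defect ψ (μ j) (φ x j) := by
          refine Finset.sum_le_sum fun j hj => ?_
          refine le_sum_defect hψ (hμ j) ((Pi.evalAddMonoidHom (fun _ : ι => F) j).comp φ) ?_
          intro h0
          have := DFunLike.congr_fun h0 g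
          simp only [supp, Finset.mem_filter] at hj
          exact hj.2 this
      _ ≤ _ := Finset.sum_le_sum_of_subset_of_nonneg (Finset.subset_univ _) fun j _ _ =>
          Finset.sum_nonneg fun x _ => defect_nonneg (hμ j).1 _
  have hc : (0 : ℝ) < Fintype.card G := Nat.cast_pos.2 Fintype.card_pos
  nlinarith

/-- Comparison of a product measure with its lazy symmetrisation on a subspace whose orthogonal
complement has no sparse vectors. -/
lemma pr_le_pr_lazy [DecidableEq ι] (hψ : ψ.IsPrimitive) {α : ℝ} {μ : ι → F → ℝ}
    (hμ : ∀ j, IsBalanced α (μ j)) (V : Submodule F (ι → F)) (m : ℕ) {s : ℝ} (hs0 : 0 ≤ s)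
    (hV : ∀ v ∈ perp V, v ≠ 0 → 4 ^ m * s < α * (supp v).card) :
    pr (pw μ) (fun x => x ∈ V) ≤ Real.exp (-(s / 2)) + (Fintype.card (perp V) : ℝ)⁻¹ +
      (2 / 3) ^ m * pr (pw fun j => lazy (1 / (4 * 4 ^ m)) (μ j)) (fun x => x ∈ V) := by
  have hp : ∀ j, IsProb (μ j) := fun j => (hμ j).isProb
  have h1 := sum_exp_le (G := perp V) (h := fun v => height ψ μ v.1) (S := 4 ^ m * s)
    (fun v => height_nonneg hp _) (fun v => height_neg _ _) (fun v w => height_add_le hp _ _)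
    (height_zero _) (by
      intro H hH
      rw [AddSubgroup.eq_bot_iff_forall]
      intro x hx
      by_contra hne
      have h2 := mul_card_supp_le hψ hμ (G := H)
        ((perp V).toAddSubgroup.subtype.comp H.subtype) (S := 4 ^ m * s)
        (fun g => hH g.1 g.2) ⟨x, hx⟩
      have h3 := hV x.1 x.2 (fun h => hne (Subtype.ext h))
      exact absurd h2 (not_le.2 h3)) m hs0 le_rfl
  have h2 := card_perp_mul_pr_le hψ hp V
  have hK : (1 : ℝ) ≤ 4 ^ m := one_le_pow₀ (by norm_num)
  have h3 := le_card_perp_mul_pr_lazy hψ hp V (β := 1 / (4 * 4 ^ m)) (by positivity) (by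
    rw [div_le_div_iff₀ (by positivity) (by norm_num)]
    linarith)
  have h4 : ∀ v : perp V, 2 * (1 / (4 * 4 ^ m)) * height ψ μ v.1 =
      height ψ μ v.1 / (2 * 4 ^ m) := by
    intro v
    field_simp
    ring
  simp only [h4] at h3
  have hc := card_perp_pos V
  refine le_of_mul_le_mul_left (a := (Fintype.card (perp V) : ℝ)) ?_ hc
  have h5 : (Fintype.card (perp V) : ℝ) * (Fintype.card (perp V) : ℝ)⁻¹ = 1 := by
    field_simp
  have h6 : (0 : ℝ) ≤ (2 / 3) ^ m := by positivity
  have h7 := mul_le_mul_of_nonneg_left h3 h6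
  calc _ ≤ _ := h2
    _ ≤ _ := h1
    _ ≤ _ := add_le_add_right h7 _
    _ = _ := by rw [mul_add, mul_add, h5]; ring

end Comparison

section Swap

variable {F E : Type*} [Field F] [AddCommGroup E] [Module F E] [Fintype E]

/-- `r` independent samples are likely to be independent and contained in `V` as soon as all
subspaces of dimension less than `r` have small measure. -/
lemma le_pr_linearIndependent_mem {ν : E → ℝ} (hν : IsProb ν) (V : Submodule F E) {r : ℕ} {b : ℝ}
    (hb : ∀ W : Submodule F E, Module.finrank F W + 1 ≤ r → pr ν (fun x => x ∈ W) ≤ b)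
    (hrb : r * b ≤ pr ν (fun x => x ∈ V) / 2) (hpos : 0 < pr ν (fun x => x ∈ V)) :
    pr ν (fun x => x ∈ V) ^ r / 2 ≤
      pr (pw fun _ : Fin r => ν) (fun Y => LinearIndependent F Y ∧ ∀ i, Y i ∈ V) := by
  set p := pr ν (fun x => x ∈ V) with hp
  set w : Fin r → E → ℝ := fun _ x => if x ∈ V then ν x else 0 with hw
  have hw0 : ∀ i x, 0 ≤ w i x := fun i x => by
    simp only [hw]; split_ifs
    exacts [hν.1 x, le_rfl]
  have hwν : ∀ i x, w i x ≤ ν x := fun i x => by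
    simp only [hw]; split_ifs
    exacts [le_rfl, hν.1 x]
  have hwp : ∀ i, ∑ a, w i a = p := fun i => rfl
  have htot : ∑ Y, pw w Y = p ^ r := by
    rw [sum_pw]; simp [hwp]
  have hdep : ∀ i : Fin r, p * pr (pw w) (fun Y => Y i ∈ Submodule.span F (Y '' (Set.univ \ {i})))
      ≤ p ^ r * b := by
    intro i
    have h1 := resample w i
      (fun Y => if Y i ∈ Submodule.span F (Y '' (Set.univ \ {i})) then 1 else 0)
    have h2 : ∀ Y : Fin r → E, ∑ a, w i a * (if Function.update Y i a i ∈
        Submodule.span F (Function.update Y i a '' (Set.univ \ {i})) then (1 : ℝ) else 0) ≤ b := by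
      intro Y
      have h3 : ∀ a, Function.update Y i a '' (Set.univ \ {i}) = Y '' (Set.univ \ {i}) := by
        intro a
        refine Set.image_congr fun j hj => ?_
        exact Function.update_of_ne (by simpa using hj) _ _
      have h4 : Module.finrank F (Submodule.span F (Y '' (Set.univ \ {i}))) + 1 ≤ r := by
        have h5 : Y '' (Set.univ \ {i}) = ((Finset.univ.erase i).image Y : Finset E) := by
          ext; simp
        have h6 := finrank_span_finset_le_card (R := F) ((Finset.univ.erase i).image Y)
        rw [Set.finrank, ← h5] at h6
        have h7 := Finset.card_image_le (s := Finset.univ.erase i) (f := Y)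
        rw [Finset.card_erase_of_mem (Finset.mem_univ i), Finset.card_univ, Fintype.card_fin] at h7
        have := i.pos
        omega
      refine le_trans (Finset.sum_le_sum fun a _ => ?_) (hb _ h4)
      rw [h3, Function.update_self]
      split_ifs
      · rw [mul_one]; exact hwν i a
      · rw [mul_zero]
    have h8 : pr (pw w) (fun Y => Y i ∈ Submodule.span F (Y '' (Set.univ \ {i}))) =
        ∑ Y, pw w Y * (if Y i ∈ Submodule.span F (Y '' (Set.univ \ {i})) then 1 else 0) := by
      unfold pr
      exact Finset.sum_congr rfl fun _ _ => by split_ifs <;> simp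
    rw [h8, ← hwp i, h1, hwp i, ← htot, Finset.sum_mul]
    exact Finset.sum_le_sum fun Y _ => mul_le_mul_of_nonneg_left (h2 Y) (pw_nonneg hw0 Y)
  have hnot : pr (pw w) (fun Y => ¬ LinearIndependent F Y) ≤ p ^ r / 2 := by
    have h1 : pr (pw w) (fun Y => ¬ LinearIndependent F Y) ≤
        ∑ i, pr (pw w) (fun Y => Y i ∈ Submodule.span F (Y '' (Set.univ \ {i}))) := by
      refine le_trans (pr_mono (pw_nonneg hw0) fun Y hY => ?_)
        (pr_exists_le (pw_nonneg hw0) Finset.univ _)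
      rw [linearIndependent_iff_notMem_span] at hY
      push Not at hY
      simpa using hY
    have h2 := Finset.sum_le_sum fun i (_ : i ∈ (Finset.univ : Finset (Fin r))) => hdep i
    rw [← Finset.mul_sum, Finset.sum_const, Finset.card_univ, Fintype.card_fin,
      nsmul_eq_mul] at h2
    have h3 : (r : ℝ) * (p ^ r * b) ≤ p * (p ^ r / 2) := by
      have := mul_le_mul_of_nonneg_left hrb (pow_nonneg hpos.le r)
      linarith
    have h4 := mul_le_mul_of_nonneg_left h1 hpos.le
    exact le_of_mul_le_mul_left (h4.trans (h2.trans h3)) hpos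
  have heq : pr (pw fun _ : Fin r => ν) (fun Y => LinearIndependent F Y ∧ ∀ i, Y i ∈ V) =
      pr (pw w) (fun Y => LinearIndependent F Y) := by
    unfold pr
    refine Finset.sum_congr rfl fun Y _ => ?_
    have : pw w Y = if ∀ i, Y i ∈ V then pw (fun _ : Fin r => ν) Y else 0 := by
      unfold pw
      split_ifs with h
      · exact Finset.prod_congr rfl fun i _ => by simp [hw, h i]
      · push Not at h
        obtain ⟨i, hi⟩ := h
        exact Finset.prod_eq_zero (Finset.mem_univ i) (by simp [hw, hi])
    rw [this]
    split_ifs <;> simp_all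
  have hsplit : pr (pw w) (fun Y => LinearIndependent F Y) +
      pr (pw w) (fun Y => ¬ LinearIndependent F Y) = p ^ r := by
    rw [← htot]
    unfold pr
    rw [← Finset.sum_add_distrib]
    exact Finset.sum_congr rfl fun _ _ => by split_ifs <;> simp_all
  rw [heq]
  linarith

/-- The event that a family is linearly independent and contained in `V`. -/
def IndepIn {ι : Type*} (V : Submodule F E) (X : ι → E) : Prop :=
  LinearIndependent F X ∧ ∀ i, X i ∈ V

/-- The probability that fresh samples `Y`, together with the rows outside `I`, are linearly
independent and contained in `V`. -/
def mixedProb {k : ℕ} (w : Fin k → E → ℝ) (ν : E → ℝ) (r : ℕ) (I : Finset (Fin k))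
    (V : Submodule F E) : ℝ :=
  ∑ Y : Fin r → E, pw (fun _ => ν) Y * ∑ y : {i // i ∉ I} → E,
    pw (fun i : {i // i ∉ I} => w i.1) y * if IndepIn V (Sum.elim Y y) then 1 else 0

lemma pr_mul_pr_le_mixedProb {k r : ℕ} {w : Fin k → E → ℝ} (hw : ∀ i, IsProb (w i)) {ν : E → ℝ}
    (hν : IsProb ν) {V : Submodule F E} (hV : Module.finrank F V = k) :
    pr (pw w) (IndepIn V) * pr (pw fun _ : Fin r => ν) (IndepIn V) ≤
      ∑ I ∈ Finset.powersetCard r Finset.univ,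
        (∏ i ∈ I, pr (w i) (fun x => x ∈ V)) * mixedProb w ν r I V := by
  have h1 : ∀ I : Finset (Fin k), (∏ i ∈ I, pr (w i) (fun x => x ∈ V)) * mixedProb w ν r I V =
      ∑ Y : Fin r → E, ∑ X, pw (fun _ => ν) Y * (pw w X * ((if ∀ i ∈ I, X i ∈ V then 1 else 0) *
        if IndepIn V (Sum.elim Y fun i : {i // i ∉ I} => X i.1) then 1 else 0)) := by
    intro I
    unfold mixedProb
    rw [Finset.mul_sum]
    refine Finset.sum_congr rfl fun Y _ => ?_
    have h := sum_pw_split w I (fun x => x ∈ V)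
      (fun y => if IndepIn V (Sum.elim Y y) then 1 else 0)
    rw [← Finset.mul_sum, mul_left_comm, ← h]
    congr!
  have h2 : pr (pw w) (IndepIn V) * pr (pw fun _ : Fin r => ν) (IndepIn V) =
      ∑ Y : Fin r → E, ∑ X, pw (fun _ => ν) Y * (pw w X *
        if IndepIn V X ∧ IndepIn V Y then 1 else 0) := by
    unfold pr
    rw [Finset.sum_mul_sum, Finset.sum_comm]
    refine Finset.sum_congr rfl fun Y _ => Finset.sum_congr rfl fun X _ => ?_
    by_cases hX : IndepIn V X <;> by_cases hY : IndepIn V Y <;> simp [hX, hY, mul_comm]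
  rw [h2, Finset.sum_congr rfl fun I _ => h1 I,
    Finset.sum_comm (s := Finset.powersetCard r Finset.univ)]
  refine Finset.sum_le_sum fun Y _ => ?_
  rw [Finset.sum_comm (s := Finset.powersetCard r Finset.univ)]
  refine Finset.sum_le_sum fun X _ => ?_
  rw [← Finset.mul_sum, ← Finset.mul_sum]
  refine mul_le_mul_of_nonneg_left (mul_le_mul_of_nonneg_left ?_ (pw_nonneg (fun i => (hw i).1) X))
    (pw_nonneg (fun _ => hν.1) Y)
  have hnn : ∀ I ∈ Finset.powersetCard r (Finset.univ : Finset (Fin k)),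
      (0 : ℝ) ≤ (if ∀ i ∈ I, X i ∈ V then 1 else 0) *
        if IndepIn V (Sum.elim Y fun i : {i // i ∉ I} => X i.1) then 1 else 0 := fun I _ =>
    mul_nonneg (by split_ifs <;> norm_num) (by split_ifs <;> norm_num)
  split_ifs with h
  · obtain ⟨⟨hX, hXV⟩, hY, hYV⟩ := h
    obtain ⟨I, hI, hLI⟩ := exists_exchange hV hX hXV hY hYV
    refine le_trans ?_ (Finset.single_le_sum hnn (Finset.mem_powersetCard.2
      ⟨Finset.subset_univ I, hI⟩))
    have : IndepIn V (Sum.elim Y fun i : {i // i ∉ I} => X i.1) := by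
      refine ⟨hLI, ?_⟩
      rintro (i | i)
      · exact hYV i
      · exact hXV i.1
    rw [if_pos this, if_pos fun i _ => hXV i, one_mul]
  · exact Finset.sum_nonneg hnn

lemma sum_indepIn_le_one {ι : Type*} [Fintype ι] (s : Finset (Submodule F E))
    (hs : ∀ V ∈ s, Module.finrank F V = Fintype.card ι) (X : ι → E) :
    ∑ V ∈ s, (if IndepIn V X then (1 : ℝ) else 0) ≤ 1 := by
  have h : ∀ V ∈ s, IndepIn V X → V = Submodule.span F (Set.range X) := by
    intro V hV hX
    refine (Submodule.eq_of_le_of_finrank_eq ?_ ?_).symm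
    · rw [Submodule.span_le]
      rintro _ ⟨i, rfl⟩
      exact hX.2 i
    · rw [finrank_span_eq_card hX.1, hs V hV]
  calc _ ≤ ∑ V ∈ s, (if V = Submodule.span F (Set.range X) then (1 : ℝ) else 0) := by
        refine Finset.sum_le_sum fun V hV => ?_
        by_cases hX : IndepIn V X
        · rw [if_pos hX, if_pos (h V hV hX)]
        · rw [if_neg hX]; split_ifs <;> norm_num
    _ ≤ 1 := by
        rw [Finset.sum_ite_eq']
        split_ifs <;> norm_num

lemma sum_mixedProb_le_one {k r : ℕ} {w : Fin k → E → ℝ} (hw : ∀ i, IsProb (w i)) {ν : E → ℝ}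
    (hν : IsProb ν) (s : Finset (Submodule F E)) (hs : ∀ V ∈ s, Module.finrank F V = k)
    {I : Finset (Fin k)} (hI : I.card = r) : ∑ V ∈ s, mixedProb w ν r I V ≤ 1 := by
  unfold mixedProb
  have hcard : Fintype.card (Fin r ⊕ {i // i ∉ I}) = k := by
    have h1 := Finset.card_le_univ I
    rw [Fintype.card_fin] at h1
    rw [Fintype.card_sum, Fintype.card_fin, Fintype.card_subtype_compl, Fintype.card_fin,
      Fintype.card_coe, hI]
    omega
  rw [Finset.sum_comm]
  have h1 : ∀ Y : Fin r → E, ∑ V ∈ s, pw (fun _ => ν) Y * ∑ y : {i // i ∉ I} → E,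
      pw (fun i : {i // i ∉ I} => w i.1) y * (if IndepIn V (Sum.elim Y y) then (1 : ℝ) else 0) ≤
        pw (fun _ => ν) Y := by
    intro Y
    rw [← Finset.mul_sum, Finset.sum_comm]
    have hwp : IsProb (pw fun i : {i // i ∉ I} => w i.1) := IsProb.pw fun i => hw i.1
    have h2 : ∑ y : {i // i ∉ I} → E, ∑ V ∈ s, pw (fun i : {i // i ∉ I} => w i.1) y *
        (if IndepIn V (Sum.elim Y y) then (1 : ℝ) else 0) ≤ 1 := by
      refine le_trans (Finset.sum_le_sum fun y _ => ?_) hwp.2.le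
      rw [← Finset.mul_sum]
      exact mul_le_of_le_one_right (hwp.1 y)
        (sum_indepIn_le_one s (fun V hV => (hs V hV).trans hcard.symm) _)
    exact mul_le_of_le_one_right (pw_nonneg (fun _ => hν.1) Y) h2
  have hνp : IsProb (pw fun _ : Fin r => ν) := IsProb.pw fun _ => hν
  calc _ ≤ _ := Finset.sum_le_sum fun Y _ => h1 Y
    _ = 1 := hνp.2

/-- The swapping bound: rows rarely span a subspace which a fixed lazy measure charges much more
than all the row measures. -/
lemma sum_pr_indepIn_le {k r : ℕ} {w : Fin k → E → ℝ} (hw : ∀ i, IsProb (w i)) {ν : E → ℝ}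
    (hν : IsProb ν) (s : Finset (Submodule F E)) (hs : ∀ V ∈ s, Module.finrank F V = k)
    {b : ℝ} (hb : ∀ W : Submodule F E, Module.finrank F W + 1 ≤ r → pr ν (fun x => x ∈ W) ≤ b)
    (hpos : ∀ V ∈ s, 0 < pr ν (fun x => x ∈ V))
    (hrb : ∀ V ∈ s, r * b ≤ pr ν (fun x => x ∈ V) / 2)
    (hcmp : ∀ V ∈ s, ∀ i, pr (w i) (fun x => x ∈ V) ≤ pr ν (fun x => x ∈ V) / 64) :
    ∑ V ∈ s, pr (pw w) (IndepIn V) ≤ 2 * 2 ^ k / 64 ^ r := by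
  have hQ0 : ∀ (I : Finset (Fin k)) (V : Submodule F E), 0 ≤ mixedProb w ν r I V := fun I V =>
    Finset.sum_nonneg fun Y _ => mul_nonneg (pw_nonneg (fun _ => hν.1) Y) <|
      Finset.sum_nonneg fun y _ => mul_nonneg (pw_nonneg (fun i => (hw i.1).1) y)
        (by split_ifs <;> norm_num)
  have h1 : ∀ V ∈ s, pr (pw w) (IndepIn V) ≤
      2 / 64 ^ r * ∑ I ∈ Finset.powersetCard r Finset.univ, mixedProb w ν r I V := by
    intro V hV
    have hp := hpos V hV
    set p := pr ν (fun x => x ∈ V) with hp_def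
    have h2 := le_pr_linearIndependent_mem hν V hb (hrb V hV) hp
    have h3 := pr_mul_pr_le_mixedProb (r := r) hw hν (hs V hV)
    have h4 : ∑ I ∈ Finset.powersetCard r Finset.univ,
        (∏ i ∈ I, pr (w i) (fun x => x ∈ V)) * mixedProb w ν r I V ≤
          (p / 64) ^ r * ∑ I ∈ Finset.powersetCard r Finset.univ, mixedProb w ν r I V := by
      rw [Finset.mul_sum]
      refine Finset.sum_le_sum fun I hI => mul_le_mul_of_nonneg_right ?_ (hQ0 I V)
      rw [← (Finset.mem_powersetCard.1 hI).2, ← Finset.prod_const]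
      exact Finset.prod_le_prod (fun i _ => pr_nonneg (hw i).1 _) fun i _ => hcmp V hV i
    have hE : 0 ≤ pr (pw w) (IndepIn V) := pr_nonneg (pw_nonneg fun i => (hw i).1) _
    have h5 : pr (pw w) (IndepIn V) * (p ^ r / 2) ≤
        (p / 64) ^ r * ∑ I ∈ Finset.powersetCard r Finset.univ, mixedProb w ν r I V :=
      (mul_le_mul_of_nonneg_left h2 hE).trans (h3.trans h4)
    have hpr : 0 < p ^ r := pow_pos hp r
    refine le_of_mul_le_mul_right (h5.trans (le_of_eq ?_)) (half_pos hpr)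
    rw [div_pow]
    field_simp
  calc _ ≤ _ := Finset.sum_le_sum h1
    _ = 2 / 64 ^ r * ∑ I ∈ Finset.powersetCard r Finset.univ, ∑ V ∈ s, mixedProb w ν r I V := by
        rw [← Finset.mul_sum, Finset.sum_comm]
    _ ≤ 2 / 64 ^ r * ∑ I ∈ Finset.powersetCard r (Finset.univ : Finset (Fin k)), 1 := by
        refine mul_le_mul_of_nonneg_left (Finset.sum_le_sum fun I hI => ?_) (by positivity)
        exact sum_mixedProb_le_one hw hν s hs (Finset.mem_powersetCard.1 hI).2
    _ ≤ 2 / 64 ^ r * 2 ^ k := by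
        refine mul_le_mul_of_nonneg_left ?_ (by positivity)
        rw [Finset.sum_const, nsmul_eq_mul, mul_one, Finset.card_powersetCard, Finset.card_univ,
          Fintype.card_fin]
        exact_mod_cast Nat.choose_le_two_pow k r
    _ = _ := by ring

end Swap

section Step

variable {F E : Type*} [Field F] [AddCommGroup E] [Module F E] [Fintype E]

/-- Adding one row: comparison of the probability of independence with its ideal recursion. -/
lemma abs_pr_linearIndependent_succ_le {k : ℕ} {w : Fin (k + 1) → E → ℝ} (hw : ∀ i, IsProb (w i))
    {c e : ℝ} (hc0 : 0 ≤ c) (hc1 : c ≤ 1) (he : 0 ≤ e) (P : (Fin k → E) → Prop)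
    (hP : ∀ x, LinearIndependent F x →
      P x ∨ |pr (w (Fin.last k)) (fun a => a ∈ Submodule.span F (Set.range x)) - c| ≤ e) :
    |pr (pw w) (fun X => LinearIndependent F X) -
      (1 - c) * pr (pw fun i : Fin k => w i.castSucc) (fun x => LinearIndependent F x)| ≤
      pr (pw fun i : Fin k => w i.castSucc) (fun x => LinearIndependent F x ∧ P x) + e := by
  set w' : Fin k → E → ℝ := fun i => w i.castSucc with hw'
  have hw'p : IsProb (pw w') := IsProb.pw fun i => hw _
  have h1 : pr (pw w) (fun X => LinearIndependent F X) = ∑ x, pw w' x *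
      if LinearIndependent F x then
        (1 - pr (w (Fin.last k)) (fun a => a ∈ Submodule.span F (Set.range x))) else 0 := by
    have h2 := sum_pw_snoc w (fun X => if LinearIndependent F X then 1 else 0)
    have h3 : pr (pw w) (fun X => LinearIndependent F X) =
        ∑ X, pw w X * if LinearIndependent F X then 1 else 0 := by
      unfold pr
      exact Finset.sum_congr rfl fun _ _ => by split_ifs <;> simp
    rw [h3, h2]
    refine Finset.sum_congr rfl fun x _ => ?_
    simp only [linearIndependent_finSnoc, mul_assoc, ← Finset.mul_sum]
    congr 1
    split_ifs with hx
    · rw [pr_compl (hw (Fin.last k)) (fun a => a ∈ Submodule.span F (Set.range x)), sub_sub_cancel]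
      unfold pr
      refine Finset.sum_congr rfl fun a _ => ?_
      by_cases ha : a ∈ Submodule.span F (Set.range x) <;> simp [hx, ha]
    · simp [hx]
  have h2 : (1 - c) * pr (pw w') (fun x => LinearIndependent F x) =
      ∑ x, pw w' x * if LinearIndependent F x then 1 - c else 0 := by
    unfold pr
    rw [Finset.mul_sum]
    refine Finset.sum_congr rfl fun _ _ => ?_
    split_ifs <;> ring
  rw [h1, h2, ← Finset.sum_sub_distrib]
  refine (Finset.abs_sum_le_sum_abs _ _).trans ?_
  have h3 : pr (pw w') (fun x => LinearIndependent F x ∧ P x) + e =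
      ∑ x, ((if LinearIndependent F x ∧ P x then pw w' x else 0) + pw w' x * e) := by
    rw [Finset.sum_add_distrib, ← Finset.sum_mul, hw'p.2, one_mul]
    unfold pr
    congr!
  rw [h3]
  refine Finset.sum_le_sum fun x _ => ?_
  have hx0 := hw'p.1 x
  rw [← mul_sub, abs_mul, abs_of_nonneg hx0]
  by_cases hx : LinearIndependent F x
  · simp only [hx, if_true, true_and]
    set p := pr (w (Fin.last k)) (fun a => a ∈ Submodule.span F (Set.range x)) with hp
    have hp0 : 0 ≤ p := pr_nonneg (hw _).1 _
    have hp1 : p ≤ 1 := pr_le_one (hw _) _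
    have habs : |1 - p - (1 - c)| = |p - c| := by rw [← abs_neg]; congr 1; ring
    rw [habs]
    rcases hP x hx with h | h
    · rw [if_pos h]
      have : |p - c| ≤ 1 := abs_le.2 ⟨by linarith, by linarith⟩
      nlinarith
    · have h4 : (0 : ℝ) ≤ if P x then pw w' x else 0 := by split_ifs <;> simp [hx0]
      nlinarith
  · simp only [hx, if_false, false_and, sub_self, abs_zero, mul_zero, zero_add]
    exact mul_nonneg hx0 he

lemma pr_indepIn_le {k : ℕ} {w : Fin k → E → ℝ} (hw : ∀ i, IsProb (w i)) (V : Submodule F E)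
    {c : ℝ} (hc : ∀ i, pr (w i) (fun x => x ∈ V) ≤ c) : pr (pw w) (IndepIn V) ≤ c ^ k := by
  calc pr (pw w) (IndepIn V) ≤ pr (pw w) (fun X => ∀ i, X i ∈ V) :=
        pr_mono (pw_nonneg fun i => (hw i).1) fun X hX => hX.2
    _ = ∏ i, pr (w i) (fun x => x ∈ V) := by
        unfold pr
        rw [← sum_pw]
        refine Finset.sum_congr rfl fun X _ => ?_
        unfold pw
        split_ifs with h
        · exact Finset.prod_congr rfl fun i _ => by simp [h i]
        · push Not at h
          obtain ⟨i, hi⟩ := h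
          exact (Finset.prod_eq_zero (Finset.mem_univ i) (by simp [hi])).symm
    _ ≤ ∏ _i : Fin k, c := Finset.prod_le_prod (fun i _ => pr_nonneg (hw i).1 _) fun i _ => hc i
    _ = c ^ k := by simp

lemma quarter_le_prod {x : ℝ} (h0 : 0 ≤ x) (h1 : x ≤ 1 / 2) (k : ℕ) :
    1 / 4 ≤ ∏ i ∈ Finset.range k, (1 - x ^ (i + 1)) := by
  have key : ∀ k : ℕ, 1 / 4 + (1 / 2 : ℝ) ^ (k + 2) ≤
      ∏ i ∈ Finset.range (k + 1), (1 - x ^ (i + 1)) := by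
    intro k
    induction k with
    | zero => simp; linarith
    | succ k ih =>
      rw [Finset.prod_range_succ]
      have hx : x ^ (k + 1 + 1) ≤ (1 / 2 : ℝ) ^ (k + 2) := pow_le_pow_left₀ h0 h1 _
      have hy : (1 / 2 : ℝ) ^ (k + 2) ≤ 1 / 4 := by
        rw [pow_add]
        have : (1 / 2 : ℝ) ^ k ≤ 1 := pow_le_one₀ (by norm_num) (by norm_num)
        linarith
      have hy0 : (0 : ℝ) < (1 / 2 : ℝ) ^ (k + 2) := by positivity
      have e : (1 / 2 : ℝ) ^ (k + 1 + 2) = (1 / 2 : ℝ) ^ (k + 2) / 2 := by ring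
      rw [e]
      set y := (1 / 2 : ℝ) ^ (k + 2)
      calc 1 / 4 + y / 2 ≤ (1 / 4 + y) * (1 - y) := by nlinarith
        _ ≤ _ := mul_le_mul ih (by linarith) (by linarith) (le_trans (by positivity) ih)
  rcases k with _ | k
  · norm_num
  · exact le_trans (by have : (0 : ℝ) < (1 / 2) ^ (k + 2) := by positivity
                       linarith) (key k)

lemma pow_le_four_mul_card_indepIn [Fintype F] {k : ℕ} (V : Submodule F E)
    (hV : Module.finrank F V = k) :
    ((Fintype.card F : ℝ) ^ (k * k)) ≤
      4 * ∑ X : Fin k → E, if IndepIn V X then (1 : ℝ) else 0 := by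
  have h1 : ∑ X : Fin k → E, (if IndepIn V X then (1 : ℝ) else 0) =
      Nat.card { s : Fin k → V // LinearIndependent F s } := by
    rw [Finset.sum_boole, ← Fintype.card_subtype, ← Nat.card_eq_fintype_card]
    congr 1
    refine Nat.card_congr ⟨fun X => ⟨fun i => ⟨X.1 i, X.2.2 i⟩, ?_⟩,
      fun s => ⟨fun i => (s.1 i).1, ?_, fun i => (s.1 i).2⟩, fun _ => rfl, fun _ => rfl⟩
    · exact LinearIndependent.of_comp V.subtype X.2.1
    · exact s.2.map' V.subtype V.ker_subtype
  have h2 := card_linearIndependent (K := F) (V := V) (k := k) hV.ge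
  rw [h1, h2, hV]
  set q := Fintype.card F with hq
  have hq2 : 1 < q := Fintype.one_lt_card
  have hq0 : (0 : ℝ) < q := by positivity
  have h3 : ((∏ i : Fin k, (q ^ k - q ^ (i : ℕ)) : ℕ) : ℝ) =
      q ^ (k * k) * ∏ i ∈ Finset.range k, (1 - ((q : ℝ)⁻¹) ^ (i + 1)) := by
    rw [← Finset.prod_range_reflect, ← Fin.prod_univ_eq_prod_range
      (fun j => (1 - ((q : ℝ)⁻¹) ^ (k - 1 - j + 1)) : ℕ → ℝ), pow_mul]
    have : ((q : ℝ) ^ k) ^ k = ∏ _i : Fin k, (q : ℝ) ^ k := by simp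
    rw [this, ← Finset.prod_mul_distrib, Nat.cast_prod]
    refine Finset.prod_congr rfl fun i _ => ?_
    rw [Nat.cast_sub (Nat.pow_le_pow_right hq2.le i.2.le)]
    push_cast
    have e : k - 1 - (i : ℕ) + 1 = k - i := by have := i.2; omega
    rw [e, mul_sub, mul_one, inv_pow, ← div_eq_mul_inv]
    congr 1
    rw [eq_div_iff (by positivity), ← pow_add]
    congr 1
    have := i.2
    omega
  rw [h3]
  have h4 := quarter_le_prod (x := (q : ℝ)⁻¹) (by positivity) (by
    rw [inv_le_comm₀ hq0 (by norm_num)]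
    have : (2 : ℝ) ≤ q := by exact_mod_cast hq2
    linarith) k
  have h5 : (0 : ℝ) ≤ (q : ℝ) ^ (k * k) := by positivity
  nlinarith

end Step

section Atypical

variable {F ι : Type*} [Field F] [Fintype F] [Fintype ι] [DecidableEq ι] {ψ : AddChar F ℂ}

lemma card_large_chf_le (hψ : ψ.IsPrimitive) {α : ℝ} {μ : ι → F → ℝ}
    (hμ : ∀ j, IsBalanced α (μ j)) {θ : ℝ} (hθ : 0 < θ) :
    ((Finset.univ.filter fun v : ι → F => θ < ∏ j, ‖chf ψ (μ j) (v j)‖).card : ℝ) ≤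
      (Fintype.card F * (1 - α)) ^ Fintype.card ι / θ ^ 2 := by
  rw [le_div_iff₀ (by positivity)]
  have h1 : ∑ v : ι → F, (∏ j, ‖chf ψ (μ j) (v j)‖) ^ 2 ≤
      (Fintype.card F * (1 - α)) ^ Fintype.card ι := by
    have h2 : ∑ v : ι → F, (∏ j, ‖chf ψ (μ j) (v j)‖) ^ 2 =
        ∏ j, ∑ ξ, ‖chf ψ (μ j) ξ‖ ^ 2 := by
      rw [Fintype.prod_sum]
      exact Finset.sum_congr rfl fun v _ => (Finset.prod_pow _ _ _).symm
    rw [h2]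
    calc _ ≤ ∏ _j : ι, (Fintype.card F * (1 - α) : ℝ) := by
          refine Finset.prod_le_prod (fun j _ => Finset.sum_nonneg fun _ _ => sq_nonneg _)
            fun j _ => ?_
          simp only [norm_chf_sq (hμ j).isProb]
          have h3 := le_sum_defect hψ (hμ j) (AddMonoidHom.id F) (by
            intro h
            exact one_ne_zero (DFunLike.congr_fun h (1 : F)))
          simp only [AddMonoidHom.id_apply] at h3
          rw [Finset.sum_sub_distrib]
          simp only [Finset.sum_const, Finset.card_univ, nsmul_eq_mul, mul_one]
          linarith
      _ = _ := by simp
  refine le_trans ?_ h1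
  rw [← nsmul_eq_mul, ← Finset.sum_const]
  calc _ ≤ ∑ v ∈ Finset.univ.filter fun v : ι → F => θ < ∏ j, ‖chf ψ (μ j) (v j)‖,
        (∏ j, ‖chf ψ (μ j) (v j)‖) ^ 2 := by
        refine Finset.sum_le_sum fun v hv => ?_
        exact pow_le_pow_left₀ hθ.le (Finset.mem_filter.1 hv).2.le 2
    _ ≤ _ := Finset.sum_le_sum_of_subset_of_nonneg (Finset.subset_univ _)
        fun _ _ _ => sq_nonneg _

lemma card_orthogonal_families {k : ℕ} {v : ι → F} (hv : v ≠ 0) :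
    (Finset.univ.filter fun X : Fin k → ι → F => ∀ i, v ⬝ᵥ X i = 0).card =
      (Fintype.card F ^ (Fintype.card ι - 1)) ^ k := by
  have h1 := card_perp (Submodule.span F {v})
  rw [finrank_span_singleton hv] at h1
  have h2 : (Finset.univ.filter fun X : Fin k → ι → F => ∀ i, v ⬝ᵥ X i = 0) =
      Fintype.piFinset fun _ => Finset.univ.filter fun x => x ∈ perp (Submodule.span F {v}) := by
    ext X
    simp only [Finset.mem_filter, Finset.mem_univ, true_and, Fintype.mem_piFinset]
    refine forall_congr' fun i => ?_
    rw [mem_perp, dotProduct_comm]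
    constructor
    · intro h x hx
      obtain ⟨a, rfl⟩ := Submodule.mem_span_singleton.1 hx
      rw [dotProduct_smul, h, smul_zero]
    · intro h
      exact h v (Submodule.mem_span_singleton_self v)
  rw [h2, Fintype.card_piFinset_const, ← h1, Fintype.card_subtype]

/-- Subspaces with no atypically likely row, orthogonal to a vector with a large Fourier
coefficient, are rarely spanned. -/
lemma sum_pr_indepIn_le_of_large_chf (hψ : ψ.IsPrimitive) {α : ℝ} {k : ℕ}
    (hk : k ≤ Fintype.card ι) {w : Fin k → (ι → F) → ℝ} (hw : ∀ i, IsProb (w i)) {μ : ι → F → ℝ}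
    (hμ : ∀ j, IsBalanced α (μ j)) {θ η : ℝ} (hθ : 0 < θ) (hη : 0 ≤ η)
    (s : Finset (Submodule F (ι → F))) (hs : ∀ V ∈ s, Module.finrank F V = k)
    (hw_le : ∀ V ∈ s, ∀ i, pr (w i) (fun x => x ∈ V) ≤
      (1 + η) * (Fintype.card F : ℝ)⁻¹ ^ (Fintype.card ι - k))
    (hlarge : ∀ V ∈ s, ∃ v ∈ perp V, v ≠ 0 ∧ θ < ∏ j, ‖chf ψ (μ j) (v j)‖) :
    ∑ V ∈ s, pr (pw w) (IndepIn V) ≤ 4 * (1 + η) ^ k / θ ^ 2 * (1 - α) ^ Fintype.card ι *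
      (Fintype.card F : ℝ) ^ (Fintype.card ι - k) := by
  set q : ℝ := (Fintype.card F : ℝ) with hq
  set n := Fintype.card ι with hn
  have hq0 : 0 < q := Nat.cast_pos.2 Fintype.card_pos
  set T := Finset.univ.filter fun v : ι → F => v ≠ 0 ∧ θ < ∏ j, ‖chf ψ (μ j) (v j)‖ with hT
  have hTc : (T.card : ℝ) ≤ (q * (1 - α)) ^ n / θ ^ 2 := by
    refine le_trans ?_ (card_large_chf_le hψ hμ hθ)
    exact_mod_cast Finset.card_le_card fun v hv => by
      simp only [hT, Finset.mem_filter, Finset.mem_univ, true_and] at hv ⊢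
      exact hv.2
  have hkn : k * k + (n - k) * k = n * k := by
    rw [← add_mul, Nat.add_sub_cancel' hk]
  have h1 : ∀ V ∈ s, pr (pw w) (IndepIn V) ≤
      4 * (1 + η) ^ k / q ^ (n * k) * ∑ X : Fin k → ι → F, if IndepIn V X then (1 : ℝ) else 0 := by
    intro V hV
    refine (pr_indepIn_le hw V (hw_le V hV)).trans ?_
    have h2 := pow_le_four_mul_card_indepIn V (hs V hV)
    rw [mul_pow, ← pow_mul, inv_pow]
    rw [← hq] at h2
    have h3 : (q ^ ((n - k) * k))⁻¹ = q ^ (k * k) / q ^ (n * k) := by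
      rw [← hkn, pow_add]
      field_simp
    rw [h3]
    calc (1 + η) ^ k * (q ^ (k * k) / q ^ (n * k)) =
          (1 + η) ^ k / q ^ (n * k) * q ^ (k * k) := by ring
      _ ≤ (1 + η) ^ k / q ^ (n * k) * (4 * ∑ X : Fin k → ι → F, if IndepIn V X then (1 : ℝ) else 0)
          := mul_le_mul_of_nonneg_left h2 (by positivity)
      _ = _ := by ring
  have h4 : ∑ V ∈ s, ∑ X : Fin k → ι → F, (if IndepIn V X then (1 : ℝ) else 0) ≤
      T.card * (q ^ (n - 1)) ^ k := by
    rw [Finset.sum_comm]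
    calc _ ≤ ∑ X : Fin k → ι → F, ∑ v ∈ T, (if ∀ i, v ⬝ᵥ X i = 0 then (1 : ℝ) else 0) := by
          refine Finset.sum_le_sum fun X _ => ?_
          have hnn : ∀ v ∈ T, (0 : ℝ) ≤ if ∀ i, v ⬝ᵥ X i = 0 then 1 else 0 := fun v _ => by
            split_ifs <;> norm_num
          by_cases hX : ∃ V ∈ s, IndepIn V X
          · obtain ⟨V, hV, hVX⟩ := hX
            obtain ⟨v, hv, hv0, hvθ⟩ := hlarge V hV
            have h5 := sum_indepIn_le_one s (fun V hV => (hs V hV).trans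
              (Fintype.card_fin k).symm) X
            refine h5.trans (le_trans ?_ (Finset.single_le_sum hnn (a := v) (by simp [hT, hv0, hvθ])))
            rw [if_pos fun i => mem_perp.1 hv _ (hVX.2 i)]
          · push Not at hX
            rw [Finset.sum_eq_zero fun V hV => if_neg (hX V hV)]
            exact Finset.sum_nonneg hnn
      _ = ∑ v ∈ T, ((q ^ (n - 1)) ^ k : ℝ) := by
          rw [Finset.sum_comm]
          refine Finset.sum_congr rfl fun v hv => ?_
          have hv0 : v ≠ 0 := (Finset.mem_filter.1 hv).2.1
          have h6 := card_orthogonal_families (k := k) hv0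
          rw [Finset.sum_boole]
          have h7 : ((Finset.univ.filter fun X : Fin k → ι → F => ∀ i, v ⬝ᵥ X i = 0).card : ℝ) =
              (q ^ (n - 1)) ^ k := by rw [h6]; push_cast; rfl
          convert h7
      _ = _ := by rw [Finset.sum_const, nsmul_eq_mul]
  have h5 : q ^ n * (q ^ (n - 1)) ^ k / q ^ (n * k) = q ^ (n - k) := by
    rcases Nat.eq_zero_or_pos n with h0 | h0
    · have : k = 0 := by omega
      simp [h0, this]
    · rw [div_eq_iff (by positivity), ← pow_mul, ← pow_add, ← pow_add]
      congr 1
      have h6 : (n - 1) * k + k = n * k := by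
        rw [← Nat.succ_mul]
        congr 1
        omega
      omega
  calc _ ≤ _ := Finset.sum_le_sum h1
    _ = 4 * (1 + η) ^ k / q ^ (n * k) *
        ∑ V ∈ s, ∑ X : Fin k → ι → F, (if IndepIn V X then (1 : ℝ) else 0) := by
        rw [Finset.mul_sum]
    _ ≤ 4 * (1 + η) ^ k / q ^ (n * k) * ((q * (1 - α)) ^ n / θ ^ 2 * (q ^ (n - 1)) ^ k) := by
        refine mul_le_mul_of_nonneg_left (h4.trans ?_) (by positivity)
        exact mul_le_mul_of_nonneg_right hTc (by positivity)
    _ = 4 * (1 + η) ^ k / θ ^ 2 * (1 - α) ^ n * (q ^ n * (q ^ (n - 1)) ^ k / q ^ (n * k)) := by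
        rw [mul_pow]; ring
    _ = _ := by rw [h5]

end Atypical

section Recursion

variable {F ι : Type*} [Field F] [Fintype F] [Fintype ι] [DecidableEq ι] {ψ : AddChar F ℂ}

/-- Subspaces with atypically large measure under one of the rows are rarely spanned. -/
lemma sum_pr_indepIn_le_of_likely (hψ : ψ.IsPrimitive) {α : ℝ} (hα0 : 0 < α) (hα1 : α < 1) {k : ℕ}
    {w : Fin k → (ι → F) → ℝ} (hw : ∀ i, IsProb (w i)) {μ : ι → F → ℝ}
    (hμ : ∀ j, IsBalanced α (μ j)) {η τ : ℝ} (hη0 : 0 < η) (hη1 : η ≤ 1 / 2) (hτ : 0 < τ)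
    {m r a : ℕ} (hm : (2 / 3 : ℝ) ^ m ≤ η / 256)
    (hexp : Real.exp (-(α * a / 4 ^ m / 2)) ≤ η / 4 * τ) (hr : r ≤ Fintype.card ι)
    (hrτ : Fintype.card ι * (1 - α / (4 * 4 ^ m)) ^ (Fintype.card ι - r) ≤ 32 * τ)
    (s : Finset (Submodule F (ι → F))) (hs : ∀ V ∈ s, Module.finrank F V = k)
    (hsupp : ∀ V ∈ s, ∀ v ∈ perp V, v ≠ 0 → a < (supp v).card)
    (hmax : ∀ V ∈ s, ∀ i, pr (w i) (fun x => x ∈ V) ≤ pr (pw μ) (fun x => x ∈ V))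
    (hlarge : ∀ V ∈ s, (1 + η) * (Fintype.card F : ℝ)⁻¹ ^ (Fintype.card ι - k) ≤
      pr (pw μ) (fun x => x ∈ V))
    (hτV : ∀ V ∈ s, τ ≤ pr (pw μ) (fun x => x ∈ V)) :
    ∑ V ∈ s, pr (pw w) (IndepIn V) ≤ 2 * 2 ^ k / 64 ^ r := by
  have h4 : (1 : ℝ) ≤ 4 ^ m := one_le_pow₀ (by norm_num)
  set β : ℝ := 1 / (4 * 4 ^ m) with hβ
  have hβ0 : 0 ≤ β := by positivity
  have hβ1 : β ≤ 1 := by rw [hβ, div_le_one (by positivity)]; linarith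
  have hαβ : 1 - α / (4 * 4 ^ m) = 1 - α * β := by rw [hβ]; ring
  rw [hαβ] at hrτ
  have hb0 : 0 ≤ 1 - α * β := by nlinarith
  have hb1 : 1 - α * β ≤ 1 := by nlinarith
  have hlazy : ∀ j, IsProb (lazy β (μ j)) := fun j => isProb_lazy (hμ j).isProb hβ0 hβ1
  have hkey : ∀ V ∈ s, pr (pw μ) (fun x => x ∈ V) ≤
      pr (pw fun j => lazy β (μ j)) (fun x => x ∈ V) / 64 := by
    intro V hV
    have h1 := pr_le_pr_lazy hψ hμ V m (s := α * a / 4 ^ m) (by positivity) (by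
      intro v hv hv0
      rw [mul_div_cancel₀ _ (by positivity)]
      exact mul_lt_mul_of_pos_left (Nat.cast_lt.2 (hsupp V hV v hv hv0)) hα0)
    rw [card_perp, hs V hV, Nat.cast_pow, ← inv_pow] at h1
    have h2 := hlarge V hV
    have h3 := hτV V hV
    set ρ := pr (pw μ) (fun x => x ∈ V)
    have hπ0 : 0 ≤ pr (pw fun j => lazy β (μ j)) (fun x => x ∈ V) :=
      pr_nonneg (pw_nonneg fun j => (hlazy j).1) _
    set π := pr (pw fun j => lazy β (μ j)) (fun x => x ∈ V)
    have hQ0 : 0 ≤ (Fintype.card F : ℝ)⁻¹ ^ (Fintype.card ι - k) := by positivity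
    set Q := (Fintype.card F : ℝ)⁻¹ ^ (Fintype.card ι - k)
    have h5 : Q ≤ ρ * (1 - 2 * η / 3) := by
      have h6 := mul_le_mul_of_nonneg_right h2 (by linarith : 0 ≤ 1 - 2 * η / 3)
      have h7 : 1 ≤ (1 + η) * (1 - 2 * η / 3) := by nlinarith
      nlinarith
    have h6 : (2 / 3 : ℝ) ^ m * π ≤ η / 256 * π := mul_le_mul_of_nonneg_right hm hπ0
    have h7 : η / 4 * τ ≤ η / 4 * ρ := mul_le_mul_of_nonneg_left h3 (by linarith)
    have h8 : η * (5 / 12 * ρ) ≤ η * (π / 256) := by linarith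
    have h9 := le_of_mul_le_mul_left h8 hη0
    linarith
  refine sum_pr_indepIn_le (r := r) (b := (1 - α * β) ^ (Fintype.card ι - r)) hw
    (IsProb.pw hlazy) s hs ?_ ?_ ?_ ?_
  · intro W hW
    refine (pr_mem_submodule_le hlazy hb0 hb1 (fun j y => lazy_le (hμ j) hβ0 hβ1 y) W).trans ?_
    exact pow_le_pow_of_le_one hb0 hb1 (by omega)
  · intro V hV
    have := hkey V hV
    have := hτV V hV
    linarith
  · intro V hV
    have h1 := hkey V hV
    have h2 := hτV V hV
    have h3 : (r : ℝ) * (1 - α * β) ^ (Fintype.card ι - r) ≤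
        Fintype.card ι * (1 - α * β) ^ (Fintype.card ι - r) :=
      mul_le_mul_of_nonneg_right (Nat.cast_le.2 hr) (pow_nonneg hb0 _)
    linarith
  · intro V hV i
    exact (hmax V hV i).trans (hkey V hV)

/-- The error made by one step of the recursion for the probability of independence. -/
lemma abs_pr_linearIndependent_step_le {α : ℝ} (hα0 : 0 < α) (hα1 : α < 1)
    {k : ℕ} (hk : k ≤ Fintype.card ι) {μ : Fin (k + 1) → ι → F → ℝ}
    (hμ : ∀ i j, IsBalanced α (μ i j)) {η θ τ : ℝ} (hη0 : 0 < η) (hη1 : η ≤ 1 / 2) (hθ : 0 < θ)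
    (hτ : 0 < τ) {m r a : ℕ} (hm : (2 / 3 : ℝ) ^ m ≤ η / 256)
    (hexp : Real.exp (-(α * a / 4 ^ m / 2)) ≤ η / 4 * τ) (hr : r ≤ Fintype.card ι)
    (hrτ : Fintype.card ι * (1 - α / (4 * 4 ^ m)) ^ (Fintype.card ι - r) ≤ 32 * τ) :
    |pr (pw fun i => pw (μ i)) (fun X => LinearIndependent F X) -
      (1 - (Fintype.card F : ℝ)⁻¹ ^ (Fintype.card ι - k)) *
        pr (pw fun i : Fin k => pw (μ i.castSucc)) (fun x => LinearIndependent F x)| ≤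
      (Finset.univ.filter fun S : Finset ι => S.card ≤ a).card * Fintype.card ι *
        (1 - α) ^ (k - a) + (k + 1) * (2 * 2 ^ k / 64 ^ r) +
        4 * (1 + η) ^ k / θ ^ 2 * (1 - α) ^ Fintype.card ι / τ + (θ + 2 * τ) := by
  obtain ⟨ψ, hψ⟩ : ∃ ψ : AddChar F ℂ, ψ.IsPrimitive :=
    ⟨_, AddChar.FiniteField.primitiveChar_to_Complex_isPrimitive F⟩
  have hp : ∀ i j, IsProb (μ i j) := fun i j => (hμ i j).isProb
  have hw : ∀ i, IsProb (pw (μ i)) := fun i => IsProb.pw (hp i)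
  have hq1 : (1 : ℝ) ≤ Fintype.card F := Nat.one_le_cast.2 Fintype.card_pos
  set Q : ℝ := (Fintype.card F : ℝ)⁻¹ ^ (Fintype.card ι - k) with hQ
  have hQ0 : 0 < Q := by positivity
  have hQ1 : Q ≤ 1 := pow_le_one₀ (by positivity) (inv_le_one_of_one_le₀ hq1)
  set w' : Fin k → (ι → F) → ℝ := fun i => pw (μ i.castSucc) with hw'
  have hw'p : ∀ i, IsProb (w' i) := fun i => hw _
  have hpw0 : ∀ x, 0 ≤ pw w' x := pw_nonneg fun i => (hw'p i).1
  let ρ : Fin (k + 1) → Submodule F (ι → F) → ℝ := fun i V => pr (pw (μ i)) (fun x => x ∈ V)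
  let B : Fin (k + 1) → Finset (Submodule F (ι → F)) := fun t => Finset.univ.filter fun V =>
    Module.finrank F V = k ∧ (∀ v ∈ perp V, v ≠ 0 → a < (supp v).card) ∧ (∀ i, ρ i V ≤ ρ t V) ∧
      (1 + η) * Q ≤ ρ t V ∧ τ ≤ ρ t V
  let A : Finset (Submodule F (ι → F)) := Finset.univ.filter fun V =>
    Module.finrank F V = k ∧ (∀ i, ρ i V ≤ (1 + η) * Q) ∧ τ ≤ Q ∧
      ∃ v ∈ perp V, v ≠ 0 ∧ θ < ∏ j, ‖chf ψ (μ (Fin.last k) j) (v j)‖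
  let S : (Fin k → ι → F) → Prop := fun x => ∃ v : ι → F, v ≠ 0 ∧ (supp v).card ≤ a ∧
    ∀ i, v ⬝ᵥ x i = 0
  let P : (Fin k → ι → F) → Prop := fun x => S x ∨
    ((∃ t ∈ (Finset.univ : Finset (Fin (k + 1))), ∃ V ∈ B t, IndepIn V x) ∨ ∃ V ∈ A, IndepIn V x)
  refine (abs_pr_linearIndependent_succ_le hw hQ0.le hQ1 (e := θ + 2 * τ) (by positivity) P
    ?_).trans ?_
  · intro x hx
    set V := Submodule.span F (Set.range x) with hV
    have hVk : Module.finrank F V = k := by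
      rw [hV, finrank_span_eq_card hx, Fintype.card_fin]
    have hxV : IndepIn V x := ⟨hx, fun i => Submodule.subset_span ⟨i, rfl⟩⟩
    by_cases hS : S x
    · exact Or.inl (Or.inl hS)
    have hsupp : ∀ v ∈ perp V, v ≠ 0 → a < (supp v).card := by
      intro v hv hv0
      by_contra h
      exact hS ⟨v, hv0, not_lt.1 h, fun i => mem_perp.1 hv _ (hxV.2 i)⟩
    obtain ⟨t, -, ht⟩ := Finset.exists_max_image Finset.univ (fun i => ρ i V)
      ⟨Fin.last k, Finset.mem_univ _⟩
    have ht' : ∀ i, ρ i V ≤ ρ t V := fun i => ht i (Finset.mem_univ i)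
    by_cases hB : (1 + η) * Q ≤ ρ t V ∧ τ ≤ ρ t V
    · refine Or.inl (Or.inr (Or.inl ⟨t, Finset.mem_univ t, V, ?_, hxV⟩))
      exact Finset.mem_filter.2 ⟨Finset.mem_univ V, hVk, hsupp, ht', hB.1, hB.2⟩
    have hlast0 : 0 ≤ ρ (Fin.last k) V := pr_nonneg (hw _).1 _
    by_cases hτQ : τ ≤ Q
    · have hle : ρ t V ≤ (1 + η) * Q := by
        by_contra h
        push Not at h
        exact hB ⟨h.le, by nlinarith⟩
      by_cases hlarge : ∃ v ∈ perp V, v ≠ 0 ∧ θ < ∏ j, ‖chf ψ (μ (Fin.last k) j) (v j)‖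
      · refine Or.inl (Or.inr (Or.inr ⟨V, ?_, hxV⟩))
        exact Finset.mem_filter.2 ⟨Finset.mem_univ V, hVk, fun i => (ht' i).trans hle, hτQ, hlarge⟩
      · push Not at hlarge
        have h1 := abs_pr_sub_le hψ (hp (Fin.last k)) V hθ.le hlarge
        rw [card_perp, hVk, Nat.cast_pow, ← inv_pow] at h1
        exact Or.inr (h1.trans (by linarith))
    · right
      have hlt : ρ (Fin.last k) V ≤ 2 * τ := by
        refine (ht' _).trans ?_
        by_contra h
        push Not at h hτQ
        exact hB ⟨by nlinarith, by linarith⟩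
      push Not at hτQ
      exact abs_le.2 ⟨by linarith, by linarith⟩
  · refine add_le_add_left ?_ _
    refine (pr_mono hpw0 (E' := P) fun x hx => hx.2).trans ?_
    refine (pr_or_le hpw0 _ _).trans ?_
    rw [add_assoc]
    refine add_le_add ?_ ((pr_or_le hpw0 _ _).trans (add_le_add ?_ ?_))
    · have h1 := pr_sparse_le (μ := fun i : Fin k => μ i.castSucc) (fun i j => hp _ j)
        (b := 1 - α) (by linarith) (by linarith) (fun i j y => (hμ _ j).le y) a
      rw [Fintype.card_fin] at h1
      exact h1
    · refine (pr_exists_le hpw0 _ _).trans ?_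
      have h1 : ∀ t ∈ (Finset.univ : Finset (Fin (k + 1))),
          pr (pw w') (fun x => ∃ V ∈ B t, IndepIn V x) ≤ 2 * 2 ^ k / 64 ^ r := by
        intro t _
        refine (pr_exists_le hpw0 _ _).trans ?_
        have hmem : ∀ V ∈ B t, _ := fun V hV => (Finset.mem_filter.1 hV).2
        exact sum_pr_indepIn_le_of_likely hψ hα0 hα1 hw'p (hμ t) hη0 hη1 hτ hm hexp hr hrτ (B t)
          (fun V hV => (hmem V hV).1) (fun V hV => (hmem V hV).2.1)
          (fun V hV i => (hmem V hV).2.2.1 _) (fun V hV => (hmem V hV).2.2.2.1)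
          (fun V hV => (hmem V hV).2.2.2.2)
      refine (Finset.sum_le_sum h1).trans (le_of_eq ?_)
      simp
    · refine (pr_exists_le hpw0 _ _).trans ?_
      by_cases hτQ : τ ≤ Q
      · have hmem : ∀ V ∈ A, _ := fun V hV => (Finset.mem_filter.1 hV).2
        refine (sum_pr_indepIn_le_of_large_chf hψ hk hw'p (hμ (Fin.last k)) hθ hη0.le A
          (fun V hV => (hmem V hV).1) (fun V hV i => (hmem V hV).2.1 _)
          (fun V hV => (hmem V hV).2.2.2)).trans ?_
        rw [div_eq_mul_inv _ τ]
        have h1 : 0 < 1 - α := by linarith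
        refine mul_le_mul_of_nonneg_left ?_ (by positivity)
        rw [← inv_inv ((Fintype.card F : ℝ) ^ _), ← inv_pow]
        exact inv_anti₀ hτ hτQ
      · have hA : A = ∅ := Finset.filter_eq_empty_iff.2 fun V _ h => hτQ h.2.2.1
        rw [hA, Finset.sum_empty]
        have h1 : 0 < 1 - α := by linarith
        positivity

end Recursion

section LimitProduct

variable {x : ℝ}

lemma multipliable_one_sub_pow_add (h0 : 0 ≤ x) (h1 : x < 1) (d : ℕ) :
    Multipliable fun i : ℕ => 1 - x ^ (d + i) := by
  have h : Summable fun i : ℕ => -x ^ (d + i) := by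
    simp only [pow_add]
    exact ((summable_geometric_of_lt_one h0 h1).mul_left _).neg
  simpa [sub_eq_add_neg] using Real.multipliable_one_add_of_summable h

lemma tprod_one_sub_pow_succ (h0 : 0 ≤ x) (h1 : x < 1) (d : ℕ) :
    ∏' i : ℕ, (1 - x ^ (d + i)) = (1 - x ^ d) * ∏' i : ℕ, (1 - x ^ (d + 1 + i)) := by
  have h := multipliable_one_sub_pow_add h0 h1 (d + 1)
  have e : ∀ i, d + 1 + i = d + (i + 1) := fun i => by omega
  simp only [e] at h ⊢
  rw [tprod_eq_zero_mul' (f := fun i : ℕ => 1 - x ^ (d + i)) h, add_zero]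

lemma tprod_one_sub_pow_le_one (h0 : 0 ≤ x) (h1 : x < 1) (d : ℕ) :
    ∏' i : ℕ, (1 - x ^ (d + i)) ≤ 1 := by
  refine le_of_tendsto' (multipliable_one_sub_pow_add h0 h1 d).hasProd.tendsto_prod_nat
    fun N => Finset.prod_le_one (fun i _ => ?_) fun i _ => ?_
  · exact sub_nonneg.2 (pow_le_one₀ h0 h1.le)
  · have : 0 ≤ x ^ (d + i) := by positivity
    linarith

lemma one_sub_le_tprod_one_sub_pow (h0 : 0 ≤ x) (h1 : x ≤ 1 / 2) (d : ℕ) :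
    1 - (1 / 2) ^ d ≤ ∏' i : ℕ, (1 - x ^ (d + 1 + i)) := by
  refine ge_of_tendsto' (multipliable_one_sub_pow_add h0 (by linarith) (d + 1)).hasProd.tendsto_prod_nat
    fun N => ?_
  have key : 1 - (1 / 2 : ℝ) ^ d + (1 / 2) ^ (d + N) ≤
      ∏ i ∈ Finset.range N, (1 - x ^ (d + 1 + i)) := by
    induction N with
    | zero => simp
    | succ N ih =>
      rw [Finset.prod_range_succ]
      have h2 : ∏ i ∈ Finset.range N, (1 - x ^ (d + 1 + i)) ≤ 1 := by
        refine Finset.prod_le_one (fun i _ => ?_) fun i _ => ?_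
        · exact sub_nonneg.2 (pow_le_one₀ h0 (by linarith))
        · have : 0 ≤ x ^ (d + 1 + i) := by positivity
          linarith
      have h3 : x ^ (d + 1 + N) ≤ (1 / 2) ^ (d + 1 + N) := pow_le_pow_left₀ h0 h1 _
      have h4 : (0 : ℝ) ≤ x ^ (d + 1 + N) := by positivity
      have e1 : (1 / 2 : ℝ) ^ (d + 1 + N) = (1 / 2) ^ (d + N) / 2 := by ring
      have e2 : (1 / 2 : ℝ) ^ (d + (N + 1)) = (1 / 2) ^ (d + N) / 2 := by ring
      rw [e1] at h3
      rw [e2]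
      nlinarith
  have : (0 : ℝ) ≤ (1 / 2) ^ (d + N) := by positivity
  linarith

end LimitProduct

section Assembly

variable {F ι : Type*} [Field F] [Fintype F] [Fintype ι] [DecidableEq ι]

lemma one_sub_le_pr_linearIndependent {α : ℝ} (hα0 : 0 < α) (hα1 : α < 1) {k : ℕ}
    (hk : k ≤ Fintype.card ι) {μ : Fin k → ι → F → ℝ} (hμ : ∀ i j, IsBalanced α (μ i j)) :
    1 - k * (1 - α) ^ (Fintype.card ι - k) ≤
      pr (pw fun i => pw (μ i)) (fun X => LinearIndependent F X) := by
  have hp : ∀ i j, IsProb (μ i j) := fun i j => (hμ i j).isProb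
  induction k with
  | zero =>
    have h1 : pr (pw fun i => pw (μ i)) (fun X => LinearIndependent F X) = 1 := by
      rw [← (IsProb.pw fun i => IsProb.pw (hp i)).2]
      unfold pr
      exact Finset.sum_congr rfl fun X _ => if_pos linearIndependent_empty_type
    rw [h1]
    simp
  | succ k ih =>
    have h1 := ih (by omega) (μ := fun i => μ i.castSucc) (fun i j => hμ _ j) fun i j => hp _ j
    have hb : 0 ≤ (1 - α) ^ (Fintype.card ι - k) := pow_nonneg (by linarith) _
    have h2 := abs_pr_linearIndependent_succ_le (F := F) (fun i => IsProb.pw (hp i)) le_rfl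
      zero_le_one hb (fun _ => False) fun x hx => Or.inr (by
        rw [sub_zero, abs_of_nonneg (pr_nonneg (IsProb.pw (hp _)).1 _)]
        have h3 := pr_mem_submodule_le (hp (Fin.last k)) (b := 1 - α) (by linarith) (by linarith)
          (fun j a => (hμ _ j).le a) (Submodule.span F (Set.range x))
        rwa [finrank_span_eq_card hx, Fintype.card_fin] at h3)
    have h4 : pr (pw fun i : Fin k => pw (μ i.castSucc))
        (fun x => LinearIndependent F x ∧ False) = 0 := by simp [pr]
    rw [h4, zero_add, sub_zero, one_mul] at h2
    have h5 := (abs_le.1 h2).1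
    have h6 : (1 - α) ^ (Fintype.card ι - k) ≤ (1 - α) ^ (Fintype.card ι - (k + 1)) :=
      pow_le_pow_of_le_one (by linarith) (by linarith) (by omega)
    have h7 := mul_le_mul_of_nonneg_left h6 (Nat.cast_nonneg (α := ℝ) k)
    push_cast
    linarith

/-- If every step of the recursion with at least `k₀` rows costs at most `e`, then the errors
accumulate linearly. -/
lemma abs_pr_linearIndependent_sub_tprod_le {α : ℝ} (hα0 : 0 < α) (hα1 : α < 1) {k k₀ : ℕ}
    (hk : k ≤ Fintype.card ι) {μ : Fin k → ι → F → ℝ}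
    (hμ : ∀ i j, IsBalanced α (μ i j)) {e : ℝ} (he0 : 0 ≤ e)
    (he : ∀ l, k₀ ≤ l → l < Fintype.card ι → ∀ ν : Fin (l + 1) → ι → F → ℝ,
      (∀ i j, IsBalanced α (ν i j)) →
      |pr (pw fun i => pw (ν i)) (fun X => LinearIndependent F X) -
        (1 - (Fintype.card F : ℝ)⁻¹ ^ (Fintype.card ι - l)) *
          pr (pw fun i : Fin l => pw (ν i.castSucc)) (fun x => LinearIndependent F x)| ≤ e) :
    |pr (pw fun i => pw (μ i)) (fun X => LinearIndependent F X) -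
      ∏' i : ℕ, (1 - (Fintype.card F : ℝ)⁻¹ ^ (Fintype.card ι - k + 1 + i))| ≤
      Fintype.card ι * (1 - α) ^ (Fintype.card ι - k₀) + (1 / 2) ^ (Fintype.card ι - k₀) +
        k * e := by
  have hq2 : (2 : ℝ) ≤ Fintype.card F := by exact_mod_cast (Fintype.one_lt_card (α := F))
  have hx0 : (0 : ℝ) ≤ (Fintype.card F : ℝ)⁻¹ := by positivity
  have hx1 : (Fintype.card F : ℝ)⁻¹ ≤ 1 / 2 := by
    rw [one_div]; exact inv_anti₀ (by norm_num) hq2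
  set x := (Fintype.card F : ℝ)⁻¹ with hx
  set n := Fintype.card ι with hn
  have h1α : 0 ≤ 1 - α := by linarith
  have hsmall : ∀ k, k ≤ n → k ≤ k₀ → ∀ μ : Fin k → ι → F → ℝ, (∀ i j, IsBalanced α (μ i j)) →
      |pr (pw fun i => pw (μ i)) (fun X => LinearIndependent F X) -
        ∏' i : ℕ, (1 - x ^ (n - k + 1 + i))| ≤
        n * (1 - α) ^ (n - k₀) + (1 / 2) ^ (n - k₀) := by
    intro k hk hkk μ hμ
    have h1 := one_sub_le_pr_linearIndependent hα0 hα1 hk hμ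
    have h2 := pr_le_one (IsProb.pw fun i => IsProb.pw fun j => (hμ i j).isProb)
      (fun X => LinearIndependent F X)
    have h3 := tprod_one_sub_pow_le_one hx0 (by linarith) (n - k + 1)
    have h4 := one_sub_le_tprod_one_sub_pow hx0 hx1 (n - k)
    have h5 : (1 - α) ^ (n - k) ≤ (1 - α) ^ (n - k₀) :=
      pow_le_pow_of_le_one h1α (by linarith) (by omega)
    have h6 : (1 / 2 : ℝ) ^ (n - k) ≤ (1 / 2) ^ (n - k₀) :=
      pow_le_pow_of_le_one (by norm_num) (by norm_num) (by omega)
    have h7 : k * (1 - α) ^ (n - k) ≤ n * (1 - α) ^ (n - k₀) :=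
      mul_le_mul (Nat.cast_le.2 hk) h5 (by positivity) (by positivity)
    have h8 : 0 ≤ k * (1 - α) ^ (n - k) := by positivity
    have h9 : (0 : ℝ) ≤ (1 / 2) ^ (n - k) := by positivity
    exact abs_le.2 ⟨by linarith, by linarith⟩
  induction k with
  | zero => simpa using hsmall 0 (Nat.zero_le _) (Nat.zero_le _) μ hμ
  | succ k ih =>
    by_cases hkk : k + 1 ≤ k₀
    · refine (hsmall _ hk hkk μ hμ).trans ?_
      have : 0 ≤ ((k + 1 : ℕ) : ℝ) * e := by positivity
      linarith
    · have h1 := ih (μ := fun i => μ i.castSucc) (fun i j => hμ _ j) (by omega)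
      have h2 := he k (by omega) (by omega) μ hμ
      have e1 : n - (k + 1) + 1 = n - k := by omega
      rw [e1, tprod_one_sub_pow_succ hx0 (by linarith) (n - k)]
      set p := pr (pw fun i => pw (μ i)) (fun X => LinearIndependent F X)
      set p' := pr (pw fun i : Fin k => pw (μ i.castSucc)) (fun x => LinearIndependent F x)
      set L := ∏' i : ℕ, (1 - x ^ (n - k + 1 + i))
      have h3 : 0 ≤ x ^ (n - k) := by positivity
      have h4 : x ^ (n - k) ≤ 1 := pow_le_one₀ hx0 (by linarith)
      have e2 : p - (1 - x ^ (n - k)) * L =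
          (p - (1 - x ^ (n - k)) * p') + (1 - x ^ (n - k)) * (p' - L) := by ring
      have h5 : |(1 - x ^ (n - k)) * (p' - L)| ≤ |p' - L| := by
        rw [abs_mul, abs_of_nonneg (by linarith)]
        exact mul_le_of_le_one_left (abs_nonneg _) (by linarith)
      rw [e2]
      refine (abs_add_le _ _).trans ?_
      push_cast
      linarith

end Assembly

lemma card_filter_card_le_mul_pow_le {ι : Type*} [Fintype ι] [DecidableEq ι] {x : ℝ} (h0 : 0 ≤ x)
    (h1 : x ≤ 1) (a : ℕ) :
    ((Finset.univ.filter fun S : Finset ι => S.card ≤ a).card : ℝ) * x ^ a ≤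
      (1 + x) ^ Fintype.card ι := by
  have h2 := Fintype.sum_pow_mul_eq_add_pow ι x 1
  simp only [one_pow, mul_one] at h2
  rw [add_comm, ← h2, ← nsmul_eq_mul, ← Finset.sum_const]
  calc _ ≤ ∑ S ∈ Finset.univ.filter fun S : Finset ι => S.card ≤ a, x ^ S.card :=
        Finset.sum_le_sum fun S hS => pow_le_pow_of_le_one h0 h1 (Finset.mem_filter.1 hS).2
    _ ≤ _ := Finset.sum_le_sum_of_subset_of_nonneg (Finset.subset_univ _)
        fun S _ _ => pow_nonneg h0 _

lemma one_sub_pow_le_exp {x : ℝ} (hx : x ≤ 1) (m : ℕ) : (1 - x) ^ m ≤ Real.exp (-(x * m)) := by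
  calc (1 - x) ^ m ≤ Real.exp (-x) ^ m :=
        pow_le_pow_left₀ (by linarith) (Real.one_sub_le_exp_neg x) m
    _ = _ := by rw [← Real.exp_nat_mul]; congr 1; ring

lemma mul_exp_neg_le {c : ℝ} (hc : 0 < c) (t : ℝ) : t * Real.exp (-(c * t)) ≤ 1 / c := by
  rw [Real.exp_neg, ← div_eq_mul_inv, div_le_div_iff₀ (Real.exp_pos _) hc]
  have := Real.add_one_le_exp (c * t)
  linarith

/-- A choice of parameters which makes the error of one step exponentially small. -/
lemma exists_parameters {α : ℝ} (hα0 : 0 < α) (hα1 : α < 1) :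
    ∃ γ A : ℝ, 0 < γ ∧ γ ≤ α / 16 ∧ 0 ≤ A ∧ ∃ m : ℕ, (2 / 3 : ℝ) ^ m ≤ α / 2 / 256 ∧
      ∀ n : ℕ, 1 ≤ n → ∃ θ τ : ℝ, ∃ r a : ℕ, 0 < θ ∧ 0 < τ ∧
        Real.exp (-(α * a / 4 ^ m / 2)) ≤ α / 2 / 4 * τ ∧ r ≤ n ∧
        n * (1 - α / (4 * 4 ^ m)) ^ (n - r) ≤ 32 * τ ∧
        ∀ l : ℕ, n - n / 4 ≤ l → l < n →
          (Finset.univ.filter fun S : Finset (Fin n) => S.card ≤ a).card * n *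
            (1 - α) ^ (l - a) + (l + 1) * (2 * 2 ^ l / 64 ^ r) +
            4 * (1 + α / 2) ^ l / θ ^ 2 * (1 - α) ^ n / τ + (θ + 2 * τ) ≤
            A * n * Real.exp (-(γ * n)) := by
  obtain ⟨m, hm⟩ := exists_pow_lt_of_lt_one (show 0 < α / 2 / 256 by positivity)
    (show (2 / 3 : ℝ) < 1 by norm_num)
  have hK1 : (1 : ℝ) ≤ 4 ^ m := one_le_pow₀ (by norm_num)
  set K : ℝ := 4 ^ m with hK
  have hK0 : 0 < K := by linarith
  set Λ : ℝ := 8 / α + K / α with hΛ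
  have hΛ0 : 0 < Λ := by positivity
  have hΛ1 : 1 ≤ Λ := by
    have : 1 ≤ 8 / α := by rw [le_div_iff₀ hα0]; linarith
    have : 0 ≤ K / α := by positivity
    linarith
  have hγα : α ^ 3 / (128 * K) ≤ α / 16 := by
    rw [div_le_div_iff₀ (by positivity) (by norm_num)]
    have h1 : α ^ 2 ≤ 1 := pow_le_one₀ hα0.le hα1.le
    have h2 : α * α ^ 2 ≤ α * 1 := mul_le_mul_of_nonneg_left h1 hα0.le
    have h3 : α * 1 ≤ α * K := mul_le_mul_of_nonneg_left hK1 hα0.le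
    nlinarith
  refine ⟨α ^ 3 / (128 * K), 22 + 2 * Λ * Real.exp 1, by positivity, hγα, by positivity, m, hm.le,
    fun n hn => ?_⟩
  set γ := α ^ 3 / (128 * K) with hγ
  have hn1 : (1 : ℝ) ≤ n := Nat.one_le_cast.2 hn
  have hn0 : (0 : ℝ) < n := by linarith
  set a := ⌊α ^ 2 / 64 * n⌋₊ with ha
  have hα2 : α ^ 2 ≤ 1 := pow_le_one₀ hα0.le hα1.le
  have ha1 : (a : ℝ) ≤ α ^ 2 / 64 * n := Nat.floor_le (by positivity)
  have ha2 : α ^ 2 / 64 * n - 1 ≤ a := (Nat.sub_one_lt_floor _).le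
  have ha3 : (a : ℝ) ≤ n / 64 := by nlinarith
  set τ := Λ * Real.exp (-(α * a / K / 2)) with hτ
  have hu1 : α * a / K / 2 ≤ α / (16 * K) * n := by
    have h1 : α * a / K / 2 = α / (16 * K) * (8 * a) := by field_simp; ring
    rw [h1]
    exact mul_le_mul_of_nonneg_left (by linarith) (by positivity)
  have hu2 : α * a / K / 2 ≤ α * n / 8 := by
    refine hu1.trans ?_
    have h1 : α / (16 * K) ≤ α / 8 := div_le_div_of_nonneg_left hα0.le (by norm_num) (by linarith)
    have := mul_le_mul_of_nonneg_right h1 hn0.le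
    linarith
  have hu3 : γ * n - 1 ≤ α * a / K / 2 := by
    have h1 : α / (2 * K) * (α ^ 2 / 64 * n - 1) ≤ α / (2 * K) * a :=
      mul_le_mul_of_nonneg_left ha2 (by positivity)
    have h2 : α / (2 * K) * (α ^ 2 / 64 * n - 1) = γ * n - α / (2 * K) := by
      rw [hγ]; field_simp; ring
    have h3 : α / (2 * K) ≤ 1 := by rw [div_le_one (by positivity)]; linarith
    have h4 : α / (2 * K) * a = α * a / K / 2 := by field_simp
    linarith
  refine ⟨Real.exp (-(α * n / 16)), τ, n / 2, a, Real.exp_pos _, by positivity, ?_,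
    Nat.div_le_self _ _, ?_, ?_⟩
  · have h1 : α / 2 / 4 * τ = (1 + K / 8) * Real.exp (-(α * a / K / 2)) := by
      rw [hτ, hΛ]; field_simp; ring
    rw [h1]
    exact le_mul_of_one_le_left (Real.exp_pos _).le (by linarith)
  · have h1 := one_sub_pow_le_exp (x := α / (4 * K))
      (by rw [div_le_one (by positivity)]; linarith) (n - n / 2)
    have h2 : (n : ℝ) / 2 ≤ ((n - n / 2 : ℕ) : ℝ) := by
      have : n ≤ 2 * (n - n / 2) := by omega
      have : (n : ℝ) ≤ 2 * ((n - n / 2 : ℕ) : ℝ) := by exact_mod_cast this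
      linarith
    have h3 : Real.exp (-(α / (4 * K) * ((n - n / 2 : ℕ) : ℝ))) ≤
        Real.exp (-(α / (16 * K) * n)) * Real.exp (-(α / (16 * K) * n)) := by
      rw [← Real.exp_add]
      refine Real.exp_le_exp.2 ?_
      have h4 := mul_le_mul_of_nonneg_left h2 (by positivity : 0 ≤ α / (4 * K))
      have h5 : α / (4 * K) * (n / 2) = α / (16 * K) * n + α / (16 * K) * n := by
        field_simp; norm_num
      linarith
    have h4 := mul_exp_neg_le (c := α / (16 * K)) (by positivity) n
    have h5 : 1 / (α / (16 * K)) ≤ 32 * Λ := by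
      have h6 : 1 / (α / (16 * K)) = 16 * (K / α) := by field_simp
      have h7 : 0 ≤ 8 / α := by positivity
      have h8 : 0 ≤ K / α := by positivity
      rw [h6]; linarith
    calc _ ≤ n * (Real.exp (-(α / (16 * K) * n)) * Real.exp (-(α / (16 * K) * n))) :=
          mul_le_mul_of_nonneg_left (h1.trans h3) hn0.le
      _ = n * Real.exp (-(α / (16 * K) * n)) * Real.exp (-(α / (16 * K) * n)) := by ring
      _ ≤ 32 * Λ * Real.exp (-(α * a / K / 2)) :=
          mul_le_mul (h4.trans h5) (Real.exp_le_exp.2 (by linarith)) (Real.exp_pos _).le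
            (by positivity)
      _ = _ := by rw [hτ]; ring
  · intro l hl hln
    set G := Real.exp (-(γ * n)) with hG
    have hG0 : 0 < G := Real.exp_pos _
    have hγn : γ * n ≤ α / 16 * n := mul_le_mul_of_nonneg_right hγα hn0.le
    have hαn : 0 < α * n := by positivity
    have hquarter : Real.exp (-(α * n / 4)) ≤ G := Real.exp_le_exp.2 (by linarith)
    have h1α : 0 < 1 - α := by linarith
    have hT1 : ((Finset.univ.filter fun S : Finset (Fin n) => S.card ≤ a).card : ℝ) * n *
        (1 - α) ^ (l - a) ≤ n * G := by
      have h1 := card_filter_card_le_mul_pow_le (ι := Fin n) (x := α / 8) (by positivity)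
        (by linarith) a
      rw [Fintype.card_fin] at h1
      set N := ((Finset.univ.filter fun S : Finset (Fin n) => S.card ≤ a).card : ℝ)
      have h2 : (1 + α / 8) ^ n ≤ Real.exp (α / 8 * n) := by
        have := one_sub_pow_le_exp (x := -(α / 8)) (by linarith) n
        rwa [sub_neg_eq_add, neg_mul, neg_neg] at this
      have h3 : Real.exp (-(α * n / 8)) ≤ (α / 8) ^ a := by
        have h4 : Real.exp (-(8 / α)) ≤ α / 8 := by
          rw [Real.exp_neg, inv_le_comm₀ (Real.exp_pos _) (by positivity), inv_div]
          have := Real.add_one_le_exp (8 / α)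
          linarith
        have h5 := pow_le_pow_left₀ (Real.exp_pos _).le h4 a
        rw [← Real.exp_nat_mul] at h5
        refine le_trans (Real.exp_le_exp.2 ?_) h5
        have h6 := mul_le_mul_of_nonneg_left ha1 (by positivity : 0 ≤ 8 / α)
        have h7 : 8 / α * (α ^ 2 / 64 * n) = α * n / 8 := by field_simp; norm_num
        linarith
      have hN : N ≤ Real.exp (α * n / 4) := by
        have h4 : N * Real.exp (-(α * n / 8)) ≤ Real.exp (α / 8 * n) :=
          (mul_le_mul_of_nonneg_left h3 (Nat.cast_nonneg _)).trans (h1.trans h2)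
        have h5 := mul_le_mul_of_nonneg_right h4 (Real.exp_pos (α * n / 8)).le
        rw [mul_assoc, ← Real.exp_add, ← Real.exp_add, neg_add_cancel, Real.exp_zero, mul_one] at h5
        exact h5.trans (Real.exp_le_exp.2 (by linarith))
      have h6 : (1 - α) ^ (l - a) ≤ Real.exp (-(α * n / 2)) := by
        refine (one_sub_pow_le_exp hα1.le _).trans (Real.exp_le_exp.2 ?_)
        have h7 : 64 * a ≤ n := by
          have : (64 : ℝ) * a ≤ n := by linarith
          exact_mod_cast this
        have h8 : n ≤ 2 * (l - a) := by omega
        have h9 : (n : ℝ) ≤ 2 * ((l - a : ℕ) : ℝ) := by exact_mod_cast h8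
        have := mul_le_mul_of_nonneg_left h9 hα0.le
        linarith
      calc N * n * (1 - α) ^ (l - a) ≤ Real.exp (α * n / 4) * n * Real.exp (-(α * n / 2)) := by
            gcongr
        _ = n * Real.exp (-(α * n / 4)) := by
            rw [mul_right_comm, ← Real.exp_add, mul_comm]; congr 2; ring
        _ ≤ n * G := mul_le_mul_of_nonneg_left hquarter hn0.le
    have hT2 : ((l : ℝ) + 1) * (2 * 2 ^ l / 64 ^ (n / 2)) ≤ n * (16 * G) := by
      have h1 : (l : ℝ) + 1 ≤ n := by exact_mod_cast hln
      have h2 : (2 : ℝ) ^ l ≤ 2 ^ n := pow_le_pow_right₀ (by norm_num) hln.le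
      have h3 : (8 : ℝ) ^ n ≤ 8 * 64 ^ (n / 2) := by
        calc (8 : ℝ) ^ n ≤ 8 ^ (2 * (n / 2) + 1) := pow_le_pow_right₀ (by norm_num) (by omega)
          _ = _ := by rw [pow_succ, pow_mul]; norm_num; ring
      have h4 : (1 - 3 / 4 : ℝ) ^ n ≤ G := by
        refine (one_sub_pow_le_exp (by norm_num) n).trans (Real.exp_le_exp.2 ?_)
        have : α * n ≤ n := mul_le_of_le_one_left hn0.le hα1.le
        linarith
      have h5 : (2 : ℝ) ^ n = (1 - 3 / 4) ^ n * 8 ^ n := by rw [← mul_pow]; norm_num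
      have h6 : 2 * (2 : ℝ) ^ l / 64 ^ (n / 2) ≤ 16 * G := by
        rw [div_le_iff₀ (by positivity)]
        calc 2 * (2 : ℝ) ^ l ≤ 2 * ((1 - 3 / 4) ^ n * 8 ^ n) := by rw [← h5]; linarith
          _ ≤ 2 * (G * (8 * 64 ^ (n / 2))) := by gcongr
          _ = _ := by ring
      exact mul_le_mul h1 h6 (by positivity) hn0.le
    have hT3 : 4 * (1 + α / 2) ^ l / Real.exp (-(α * n / 16)) ^ 2 * (1 - α) ^ n / τ ≤ 4 * G := by
      have h1 : (1 + α / 2) ^ l ≤ Real.exp (α * n / 2) := by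
        refine (pow_le_pow_right₀ (by linarith) hln.le).trans ?_
        have := one_sub_pow_le_exp (x := -(α / 2)) (by linarith) n
        rw [sub_neg_eq_add, neg_mul, neg_neg] at this
        exact this.trans (Real.exp_le_exp.2 (by linarith))
      have h2 : (1 - α) ^ n ≤ Real.exp (-(α * n)) := one_sub_pow_le_exp hα1.le n
      have h3 : Real.exp (-(α * n / 8)) ≤ τ := by
        calc Real.exp (-(α * n / 8)) ≤ Real.exp (-(α * a / K / 2)) :=
              Real.exp_le_exp.2 (by linarith)
          _ ≤ τ := le_mul_of_one_le_left (Real.exp_pos _).le hΛ1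
      have h4 : Real.exp (-(α * n / 16)) ^ 2 = Real.exp (-(α * n / 8)) := by
        rw [← Real.exp_nat_mul]; congr 1; push_cast; ring
      rw [h4]
      calc _ ≤ 4 * Real.exp (α * n / 2) / Real.exp (-(α * n / 8)) * Real.exp (-(α * n)) /
            Real.exp (-(α * n / 8)) := by gcongr
        _ = 4 * Real.exp (-(α * n / 4)) := by
            have e : -(α * n / 4) = α * n / 2 + α * n / 8 + -(α * n) + α * n / 8 := by ring
            rw [e, Real.exp_add, Real.exp_add, Real.exp_add, Real.exp_neg (α * n / 8), div_inv_eq_mul,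
              div_inv_eq_mul]
            ring
        _ ≤ 4 * G := by linarith
    have hT4 : Real.exp (-(α * n / 16)) ≤ G := Real.exp_le_exp.2 (by linarith)
    have hT5 : τ ≤ Λ * Real.exp 1 * G := by
      rw [hτ, hG, mul_assoc, ← Real.exp_add]
      exact mul_le_mul_of_nonneg_left (Real.exp_le_exp.2 (by linarith)) hΛ0.le
    have hGn : G ≤ n * G := le_mul_of_one_le_left hG0.le hn1
    have h6 : Λ * Real.exp 1 * G ≤ Λ * Real.exp 1 * (n * G) :=
      mul_le_mul_of_nonneg_left hGn (by positivity)
    linarith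

theorem stmt11 (α : ℝ) (hα0 : 0 < α) (hα1 : α < 1) :
    ∃ c C : ℝ, 0 < c ∧ 0 < C ∧
      ∀ (F : Type) [Field F] [Fintype F], ∀ n : ℕ, 1 ≤ n →
        ∀ μ : Fin n → Fin n → F → ℝ, (∀ i j, IsBalanced α (μ i j)) →
        ∀ k : ℕ, ∀ hkn : k ≤ n,
          |matProb μ {M : Matrix (Fin n) (Fin n) F |
              LinearIndependent F (fun i : Fin k => M (Fin.castLE hkn i))} -
            ∏' i : ℕ, (1 - ((Fintype.card F : ℝ))⁻¹ ^ (n - k + 1 + i))| ≤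
          C * Real.exp (-(c * α * n)) := by
  obtain ⟨γ, A, hγ0, hγα, hA, m, hm, hpar⟩ := exists_parameters hα0 hα1
  refine ⟨γ / 2 / α, (2 * Real.exp 1 + A) * (4 / γ) ^ 2, by positivity, by positivity,
    fun F _ _ n hn μ hμ k hkn => ?_⟩
  obtain ⟨θ, τ, r, a, hθ, hτ, hexp, hr, hrτ, hstep⟩ := hpar n hn
  have hn1 : (1 : ℝ) ≤ n := Nat.one_le_cast.2 hn
  have hp : ∀ i, IsProb (pw (μ i)) := fun i => IsProb.pw fun j => (hμ i j).isProb
  have hP : matProb μ {M : Matrix (Fin n) (Fin n) F |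
      LinearIndependent F (fun i : Fin k => M (Fin.castLE hkn i))} =
      pr (pw fun i : Fin k => pw (μ (Fin.castLE hkn i))) (fun X => LinearIndependent F X) := by
    rw [← pr_comp_of_injective hp (Fin.castLE hkn) (Fin.castLE_injective hkn)]
    unfold matProb pr
    rw [Finset.sum_filter]
    rfl
  have h1 := abs_pr_linearIndependent_sub_tprod_le (ι := Fin n) hα0 hα1 (k₀ := n - n / 4)
    (by rwa [Fintype.card_fin]) (μ := fun i : Fin k => μ (Fin.castLE hkn i)) (fun i j => hμ _ j)
    (e := A * n * Real.exp (-(γ * n))) (by positivity) (by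
      intro l hl hln ν hν
      have h2 := abs_pr_linearIndependent_step_le (ι := Fin n) hα0 hα1 hln.le hν
        (r := r) (a := a) (η := α / 2) (by positivity) (by linarith) hθ hτ hm hexp (by rwa [Fintype.card_fin])
        (by rwa [Fintype.card_fin])
      rw [Fintype.card_fin] at h2 hln ⊢
      refine h2.trans (le_trans (le_of_eq ?_) (hstep l hl hln))
      congr!)
  have e1 : n - (n - n / 4) = n / 4 := by omega
  rw [Fintype.card_fin, e1] at h1
  rw [hP]
  refine h1.trans ?_
  set G := Real.exp (-(γ * n)) with hG
  have hfloor : (n : ℝ) / 4 - 1 ≤ ((n / 4 : ℕ) : ℝ) := by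
    have : n ≤ 4 * (n / 4) + 4 := by omega
    have : (n : ℝ) ≤ 4 * ((n / 4 : ℕ) : ℝ) + 4 := by exact_mod_cast this
    linarith
  have hαn : α * n ≤ n := mul_le_of_le_one_left (by linarith) hα1.le
  have hγn : γ * n ≤ α / 16 * n := mul_le_mul_of_nonneg_right hγα (by linarith)
  have hsmall : (1 - α) ^ (n / 4) ≤ Real.exp 1 * G := by
    refine (one_sub_pow_le_exp hα1.le _).trans ?_
    rw [hG, ← Real.exp_add]
    refine Real.exp_le_exp.2 ?_
    have := mul_le_mul_of_nonneg_left hfloor hα0.le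
    have : 0 ≤ α * n := by positivity
    linarith
  have hhalf : (1 / 2 : ℝ) ^ (n / 4) ≤ Real.exp 1 * G := by
    have h2 := one_sub_pow_le_exp (x := 1 / 2) (by norm_num) (n / 4)
    have e2 : (1 : ℝ) - 1 / 2 = 1 / 2 := by norm_num
    rw [e2] at h2
    refine h2.trans ?_
    rw [hG, ← Real.exp_add]
    exact Real.exp_le_exp.2 (by linarith)
  have hG0 : 0 < G := Real.exp_pos _
  have hn2 : (n : ℝ) ≤ n ^ 2 := by nlinarith
  have hn3 : (1 : ℝ) ≤ n ^ 2 := by nlinarith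
  have hkn' : (k : ℝ) ≤ n := Nat.cast_le.2 hkn
  have hEG : 0 < Real.exp 1 * G := by positivity
  have hAG : 0 ≤ A * n * G := by positivity
  have hsq : (n : ℝ) ^ 2 * G ≤ (4 / γ) ^ 2 * Real.exp (-(γ / 2 / α * α * n)) := by
    have h2 := mul_exp_neg_le (c := γ / 4) (by positivity) n
    have h3 := pow_le_pow_left₀ (by positivity) h2 2
    have h4 : G = Real.exp (-(γ / 4 * n)) ^ 2 * Real.exp (-(γ / 2 / α * α * n)) := by
      rw [hG, ← Real.exp_nat_mul, ← Real.exp_add]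
      congr 1
      push_cast
      field_simp
      ring
    rw [h4, ← mul_assoc, ← mul_pow]
    refine mul_le_mul_of_nonneg_right (h3.trans (le_of_eq ?_)) (Real.exp_pos _).le
    rw [one_div_div]
  calc _ ≤ n * (Real.exp 1 * G) + Real.exp 1 * G + n * (A * n * G) := by gcongr
    _ ≤ n ^ 2 * (Real.exp 1 * G) + n ^ 2 * (Real.exp 1 * G) + n * (A * n * G) := by
        have h2 := mul_le_mul_of_nonneg_right hn2 hEG.le
        have h3 := mul_le_mul_of_nonneg_right hn3 hEG.le
        linarith
    _ = (2 * Real.exp 1 + A) * (n ^ 2 * G) := by ring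
    _ ≤ (2 * Real.exp 1 + A) * ((4 / γ) ^ 2 * Real.exp (-(γ / 2 / α * α * n))) :=
        mul_le_mul_of_nonneg_left hsq (by positivity)
    _ = _ := by ring
end
end

section
/- Let q be a prime power, α ∈ (0,1), and let n ≥ m ≥ 1 be integers. Let λ₁, …, λ_m ∈ F_q and f(t) = (t − λ₁)(t − λ₂)⋯(t − λ_m). Let M be an n×n random matrix over F_q whose entries are independent and each α-balanced. Then for every nonzero vector v ∈ F_q^n: P(f(M)·v = 0) ≤ (m·(1−α)^{⌊n/m⌋})^{1/2^m}. -/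
/- STATEMENT 19: If M is an n×n random matrix over F_q with independent α-balanced
entries, f(t) = (t − λ₁)⋯(t − λ_m), and v ≠ 0, then
P(f(M)·v = 0) ≤ (m·(1−α)^{⌊n/m⌋})^{1/2^m}. -/

open scoped Classical

noncomputable section

section ProductProbability

/-- The probability of an event `E` under the product of the finite weights `p i`. -/
def prodProb {ι : Type*} [Fintype ι] [DecidableEq ι] {R : ι → Type*} [∀ i, Fintype (R i)]
    (p : ∀ i, R i → ℝ) (E : Set (∀ i, R i)) : ℝ :=
  ∑ x, if x ∈ E then ∏ i, p i (x i) else 0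

variable {ι : Type*} [Fintype ι] [DecidableEq ι] {R : ι → Type*} [∀ i, Fintype (R i)]
  {p : ∀ i, R i → ℝ}

lemma prodProb_nonneg (hp : ∀ i x, 0 ≤ p i x) (E : Set (∀ i, R i)) : 0 ≤ prodProb p E := by
  refine Finset.sum_nonneg fun x _ => ?_
  split_ifs
  · exact Finset.prod_nonneg fun i _ => hp i _
  · exact le_rfl

lemma prodProb_mono (hp : ∀ i x, 0 ≤ p i x) {E E' : Set (∀ i, R i)} (h : E ⊆ E') :
    prodProb p E ≤ prodProb p E' := by
  refine Finset.sum_le_sum fun x _ => ?_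
  have h0 : 0 ≤ ∏ i, p i (x i) := Finset.prod_nonneg fun i _ => hp i _
  by_cases hx : x ∈ E
  · simp [hx, h hx]
  · simp only [hx, if_false]
    split_ifs
    · exact h0
    · exact le_rfl

lemma prodProb_union_le (hp : ∀ i x, 0 ≤ p i x) (E E' : Set (∀ i, R i)) :
    prodProb p (E ∪ E') ≤ prodProb p E + prodProb p E' := by
  unfold prodProb
  rw [← Finset.sum_add_distrib]
  refine Finset.sum_le_sum fun x _ => ?_
  have h0 : 0 ≤ ∏ i, p i (x i) := Finset.prod_nonneg fun i _ => hp i _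
  by_cases hx : x ∈ E <;> by_cases hx' : x ∈ E' <;> simp [hx, hx', h0]

lemma sum_prod_weight_eq_one (h1 : ∀ i, ∑ x, p i x = 1) : ∑ x : ∀ i, R i, ∏ i, p i (x i) = 1 := by
  rw [← Fintype.piFinset_univ, ← Finset.prod_univ_sum]
  simp [h1]

/-- If on `E` every coordinate `i ∈ I` lies in a set of weight at most `β` that is determined by
the coordinates outside `I`, then `E` has probability at most `β ^ #I`. -/
lemma prodProb_le_pow {V : Type*} [Fintype V] {p : ι → V → ℝ} (hp : ∀ i x, 0 ≤ p i x)
    (h1 : ∀ i, ∑ x, p i x = 1) {β : ℝ} (I : Finset ι) (E : Set (ι → V))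
    (c : ι → (ι → V) → Set V)
    (hc : ∀ i ∈ I, ∀ x y : ι → V, (∀ j, j ∉ I → x j = y j) → c i x = c i y)
    (hβ : ∀ i ∈ I, ∀ x, (∑ r, if r ∈ c i x then p i r else 0) ≤ β)
    (hE : ∀ x ∈ E, ∀ i ∈ I, x i ∈ c i x) :
    prodProb p E ≤ β ^ I.card := by
  by_cases hV : Nonempty (ι → V)
  swap
  · have := sum_prod_weight_eq_one h1
    simp [not_nonempty_iff.1 hV] at this
  obtain ⟨d⟩ := hV
  let ext : ({i // i ∉ I} → V) → ι → V := fun z i => if h : i ∈ I then d i else z ⟨i, h⟩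
  calc prodProb p E
      ≤ ∑ x : ι → V, (∏ i : {i // i ∈ I}, if x i ∈ c i x then p i (x i) else 0) *
          ∏ i : {i // i ∉ I}, p i (x i) := by
        refine Finset.sum_le_sum fun x _ => ?_
        by_cases hx : x ∈ E
        · have hsplit : ∏ i, p i (x i) =
              (∏ i : {i // i ∈ I}, p i (x i)) * ∏ i : {i // i ∉ I}, p i (x i) := by
            convert (Fintype.prod_subtype_mul_prod_subtype (fun i => i ∈ I)
              fun i => p i (x i)).symm
          have hif : (∏ i : {i // i ∈ I}, if x i ∈ c i x then p i (x i) else 0) =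
              ∏ i : {i // i ∈ I}, p i (x i) :=
            Fintype.prod_congr _ _ fun i => if_pos (hE x hx i i.2)
          rw [if_pos hx, hif, hsplit]
        · rw [if_neg hx]
          refine mul_nonneg (Finset.prod_nonneg fun i _ => ?_)
            (Finset.prod_nonneg fun i _ => hp _ _)
          split_ifs
          · exact hp _ _
          · exact le_rfl
    _ = ∑ z : ({i // i ∈ I} → V) × ({i // i ∉ I} → V),
          (∏ i : {i // i ∈ I}, if z.1 i ∈ c i (ext z.2) then p i (z.1 i) else 0) *
          ∏ i : {i // i ∉ I}, p i (z.2 i) := by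
        refine Fintype.sum_equiv (Equiv.piEquivPiSubtypeProd (fun i => i ∈ I) fun _ => V) _ _ ?_
        intro x
        congr 1
        refine Finset.prod_congr rfl fun i _ => ?_
        have : c i x = c i (ext fun j => x j) := by
          refine hc i i.2 _ _ fun j hj => ?_
          simp [ext, hj]
        rw [this]
        rfl
    _ = ∑ z : {i // i ∉ I} → V,
          (∏ i : {i // i ∈ I}, ∑ r, if r ∈ c i (ext z) then p i r else 0) *
          ∏ i : {i // i ∉ I}, p i (z i) := by
        rw [Fintype.sum_prod_type_right]
        refine Finset.sum_congr rfl fun z _ => ?_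
        dsimp only
        rw [← Finset.sum_mul, Finset.prod_univ_sum, Fintype.piFinset_univ]
    _ ≤ ∑ z : {i // i ∉ I} → V, β ^ I.card * ∏ i : {i // i ∉ I}, p i (z i) := by
        refine Finset.sum_le_sum fun z _ => mul_le_mul_of_nonneg_right ?_
          (Finset.prod_nonneg fun i _ => hp _ _)
        refine (Finset.prod_le_prod (g := fun _ : {i // i ∈ I} => β)
          (fun i _ => Finset.sum_nonneg fun r _ => ?_) fun i _ => hβ i i.2 (ext z)).trans ?_
        · split_ifs
          · exact hp _ _
          · exact le_rfl
        · simp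
    _ = β ^ I.card := by
        rw [← Finset.mul_sum,
          sum_prod_weight_eq_one (p := fun i : {i // i ∉ I} => p i) fun i => h1 i, mul_one]

lemma sum_pi_fin_succ {m : ℕ} {R : Fin (m + 1) → Type*} [∀ i, Fintype (R i)]
    (f : (∀ i, R i) → ℝ) :
    ∑ x, f x = ∑ a : R 0, ∑ x : ∀ i : Fin m, R i.succ, f (Fin.cons a x) := by
  rw [← Fintype.sum_prod_type']
  exact (Fintype.sum_equiv (Fin.consEquiv R) _ _ fun _ => rfl).symm

lemma prodProb_fin_succ {m : ℕ} {R : Fin (m + 1) → Type*} [∀ i, Fintype (R i)]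
    (p : ∀ i, R i → ℝ) (E : Set (∀ i, R i)) :
    prodProb p E = ∑ a : R 0, p 0 a * prodProb (fun i : Fin m => p i.succ)
      {x | (Fin.cons a x : ∀ i, R i) ∈ E} := by
  unfold prodProb
  rw [sum_pi_fin_succ]
  refine Finset.sum_congr rfl fun a _ => ?_
  rw [Finset.mul_sum]
  refine Finset.sum_congr rfl fun x _ => ?_
  simp [Fin.prod_univ_succ]

lemma sq_prodProb_fin_succ_le {m : ℕ} {R : Fin (m + 1) → Type*} [∀ i, Fintype (R i)]
    {p : ∀ i, R i → ℝ} (hp : ∀ i x, 0 ≤ p i x) (h1 : ∀ i, ∑ x, p i x = 1)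
    (E : Set (∀ i, R i)) :
    prodProb p E ^ 2 ≤ ∑ z : R 0 × R 0, p 0 z.1 * p 0 z.2 *
      prodProb (fun i : Fin m => p i.succ)
        {x | (Fin.cons z.1 x : ∀ i, R i) ∈ E ∧ (Fin.cons z.2 x : ∀ i, R i) ∈ E} := by
  let w : (∀ i : Fin m, R i.succ) → ℝ := fun x => ∏ i, p i.succ (x i)
  let u : (∀ i : Fin m, R i.succ) → R 0 → ℝ :=
    fun x a => if (Fin.cons a x : ∀ i, R i) ∈ E then p 0 a else 0
  have hw : ∀ x, 0 ≤ w x := fun x => Finset.prod_nonneg fun i _ => hp _ _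
  have hu : ∀ x a, 0 ≤ u x a := fun x a => by
    simp only [u]
    split_ifs
    · exact hp _ _
    · exact le_rfl
  calc prodProb p E ^ 2 = (∑ x, w x * ∑ a, u x a) ^ 2 := by
        congr 1
        rw [prodProb_fin_succ]
        simp only [prodProb, Finset.mul_sum]
        rw [Finset.sum_comm]
        refine Finset.sum_congr rfl fun x _ => Finset.sum_congr rfl fun a _ => ?_
        by_cases h : (Fin.cons a x : ∀ i, R i) ∈ E
        · simp [h, u, w, mul_comm]
        · simp [h, u]
    _ ≤ ∑ x, w x * (∑ a, u x a) ^ 2 :=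
        Real.pow_arith_mean_le_arith_mean_pow _ _ _ (fun x _ => hw x)
          (sum_prod_weight_eq_one (p := fun i : Fin m => p i.succ) fun i => h1 _)
          (fun x _ => Finset.sum_nonneg fun a _ => hu x a) 2
    _ = _ := by
        simp only [prodProb, Finset.mul_sum]
        rw [Finset.sum_comm]
        refine Finset.sum_congr rfl fun x _ => ?_
        rw [sq, Finset.sum_mul_sum, ← Fintype.sum_prod_type', Finset.mul_sum]
        refine Finset.sum_congr rfl fun z _ => ?_
        by_cases h : (Fin.cons z.1 x : ∀ i, R i) ∈ E <;>
          by_cases h' : (Fin.cons z.2 x : ∀ i, R i) ∈ E <;> simp [h, h', u, w, mul_comm]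

/-- Decoupling: replacing arbitrary sets of coordinates by those of an independent copy. -/
theorem prodProb_pow_le_decoupled (m : ℕ) (R : Fin m → Type*) [∀ i, Fintype (R i)]
    (p : ∀ i, R i → ℝ) (hp : ∀ i x, 0 ≤ p i x) (h1 : ∀ i, ∑ x, p i x = 1)
    (E : Set (∀ i, R i)) :
    prodProb p E ^ 2 ^ m ≤ ∑ y : ∀ i, R i, (∏ i, p i (y i)) *
      prodProb p {x | ∀ S : Fin m → Bool, (fun t => if S t then x t else y t) ∈ E} := by
  induction m with
  | zero =>
    rw [pow_zero, pow_one, Fintype.sum_unique]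
    simp only [Finset.univ_eq_empty, Finset.prod_empty, one_mul]
    refine prodProb_mono hp fun x hx S => ?_
    convert hx
  | succ m ih =>
    let q : ∀ i : Fin m, R i.succ → ℝ := fun i => p i.succ
    have hq : ∀ i x, 0 ≤ q i x := fun i x => hp _ _
    have hq1 : ∀ i, ∑ x, q i x = 1 := fun i => h1 _
    rw [pow_succ', pow_mul]
    refine (pow_le_pow_left₀ (sq_nonneg _) (sq_prodProb_fin_succ_le hp h1 E) _).trans ?_
    refine (Real.pow_arith_mean_le_arith_mean_pow _ _ _
      (fun z _ => mul_nonneg (hp _ _) (hp _ _)) ?_ (fun z _ => prodProb_nonneg hq _) _).trans ?_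
    · rw [Fintype.sum_prod_type' (f := fun a b => p 0 a * p 0 b), ← Finset.sum_mul_sum]
      simp [h1]
    refine (Finset.sum_le_sum fun z _ => mul_le_mul_of_nonneg_left
      (ih (fun i => R i.succ) q hq hq1 _) (mul_nonneg (hp _ _) (hp _ _))).trans ?_
    rw [Fintype.sum_prod_type_right, sum_pi_fin_succ]
    refine Finset.sum_le_sum fun b _ => ?_
    simp only [Finset.mul_sum]
    rw [Finset.sum_comm]
    refine Finset.sum_le_sum fun y _ => ?_
    rw [prodProb_fin_succ, Finset.mul_sum]
    refine Finset.sum_le_sum fun a _ => ?_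
    rw [Fin.prod_univ_succ]
    simp only [Fin.cons_zero, Fin.cons_succ]
    have key : prodProb q {x | ∀ S : Fin m → Bool,
          (fun t => if S t then x t else y t) ∈
            {x | (Fin.cons a x : ∀ i, R i) ∈ E ∧ (Fin.cons b x : ∀ i, R i) ∈ E}} ≤
        prodProb q {x | (Fin.cons a x : ∀ i, R i) ∈
          {x : ∀ i, R i | ∀ S : Fin (m + 1) → Bool, (fun t => if S t then x t else
            (Fin.cons b y : ∀ i, R i) t) ∈ E}} := by
      refine prodProb_mono hq fun x hx S => ?_
      have h := hx fun t => S t.succ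
      have e : (fun t => if S t then (Fin.cons a x : ∀ i, R i) t else
          (Fin.cons b y : ∀ i, R i) t) =
          Fin.cons (if S 0 then a else b) fun t => if S t.succ then x t else y t := by
        funext t
        refine Fin.cases ?_ (fun t => ?_) t <;> simp
      rw [e]
      by_cases hS : S 0
      · simpa [hS] using h.1
      · simpa [hS] using h.2
    have hw : 0 ≤ p 0 a * p 0 b * ∏ i, q i (y i) :=
      mul_nonneg (mul_nonneg (hp _ _) (hp _ _)) (Finset.prod_nonneg fun i _ => hq _ _)
    calc _ = p 0 a * p 0 b * (∏ i, q i (y i)) * _ := by rw [← mul_assoc]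
      _ ≤ _ := mul_le_mul_of_nonneg_left key hw
      _ = _ := by simp only [q]; ring

/-- Decoupling with the coordinates grouped into `m` blocks by `b`. -/
theorem prodProb_pow_le_decoupled_blocks {V : Type*} [Fintype V] {p : ι → V → ℝ}
    (hp : ∀ i x, 0 ≤ p i x) (h1 : ∀ i, ∑ x, p i x = 1) {m : ℕ} (b : ι → Fin m)
    (E : Set (ι → V)) :
    prodProb p E ^ 2 ^ m ≤ ∑ y : ι → V, (∏ i, p i (y i)) *
      prodProb p {x | ∀ S : Fin m → Bool, (fun i => if S (b i) then x i else y i) ∈ E} := by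
  let Ω : Fin m → Type _ := fun t => {i // b i = t} → V
  let e : (ι → V) ≃ ∀ t, Ω t :=
    { toFun := fun x t i => x i
      invFun := fun x i => x (b i) ⟨i, rfl⟩
      left_inv := fun x => rfl
      right_inv := fun x => by
        funext t ⟨i, hi⟩
        subst hi
        rfl }
  let P : ∀ t, Ω t → ℝ := fun t x => ∏ i : {i // b i = t}, p i (x i)
  have hP : ∀ x : ι → V, ∏ t, P t (e x t) = ∏ i, p i (x i) := fun x =>
    Fintype.prod_fiberwise b fun i => p i (x i)
  have hprob : ∀ A : Set (ι → V), prodProb p A = prodProb P {x | e.symm x ∈ A} := fun A =>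
    Fintype.sum_equiv e _ _ fun x => by simp [hP]
  have h := prodProb_pow_le_decoupled m Ω P
    (fun t x => Finset.prod_nonneg fun i _ => hp _ _)
    (fun t => sum_prod_weight_eq_one (p := fun i : {i // b i = t} => p i) fun i => h1 i)
    {x | e.symm x ∈ E}
  rw [← hprob] at h
  refine h.trans (le_of_eq ?_)
  refine (Fintype.sum_equiv e _ _ fun y => ?_).symm
  rw [hP, hprob]
  congr 3
  ext x
  refine forall_congr' fun S => ?_
  have : (fun i => if S (b i) then e.symm x i else y i) =
      e.symm fun t => if S t then x t else e y t := by
    funext i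
    simp only [e, Equiv.coe_fn_symm_mk, Equiv.coe_fn_mk]
    split_ifs <;> rfl
  simp only [Set.mem_ofPred_eq]
  rw [this]

end ProductProbability

section Differences

variable {F : Type*} [Field F] {n : ℕ}

/-- The iterated forward difference of `h` with steps in the list `l`. -/
def iterDiff {A B : Type*} [AddCommGroup A] [AddCommGroup B] : List A → (A → B) → A → B
  | [], h => h
  | δ :: l, h => fwdDiff δ (iterDiff l h)

lemma iterDiff_fwdDiff {A B : Type*} [AddCommGroup A] [AddCommGroup B] (l : List A) (δ : A)
    (h : A → B) : iterDiff l (fwdDiff δ h) = fwdDiff δ (iterDiff l h) := by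
  induction l with
  | nil => rfl
  | cons ε l ih =>
    funext x
    simp only [iterDiff, ih, fwdDiff]
    rw [add_right_comm]
    abel

/-- `h` is killed by `k + 1` successive forward differences. -/
def HasDiffDegree {A B : Type*} [AddCommGroup A] [AddCommGroup B] : ℕ → (A → B) → Prop
  | 0, h => ∀ x y, h x = h y
  | k + 1, h => ∀ δ, HasDiffDegree k (fwdDiff δ h)

lemma HasDiffDegree.iterDiff_const {A B : Type*} [AddCommGroup A] [AddCommGroup B] (l : List A)
    (h : A → B) (hh : HasDiffDegree l.length h) (x y : A) : iterDiff l h x = iterDiff l h y := by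
  induction l generalizing h with
  | nil => exact hh x y
  | cons δ l ih =>
    simp only [iterDiff, ← iterDiff_fwdDiff]
    exact ih _ (hh δ)

lemma HasDiffDegree.add {A B : Type*} [AddCommGroup A] [AddCommGroup B] {k : ℕ} {g h : A → B}
    (hg : HasDiffDegree k g) (hh : HasDiffDegree k h) : HasDiffDegree k (g + h) := by
  induction k generalizing g h with
  | zero => exact fun x y => congrArg₂ (· + ·) (hg x y) (hh x y)
  | succ k ih =>
    intro δ
    rw [fwdDiff_add]
    exact ih (hg δ) (hh δ)

lemma HasDiffDegree.map_comp_shift {A B : Type*} [AddCommGroup A] [AddCommGroup B] {k : ℕ}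
    {h : A → B} (hh : HasDiffDegree k h) (φ : B →+ B) (ε : A) :
    HasDiffDegree k fun x => φ (h (x + ε)) := by
  induction k generalizing h with
  | zero => exact fun x y => congrArg φ (hh _ _)
  | succ k ih =>
    intro δ
    convert ih (hh δ) using 1
    funext x
    simp only [fwdDiff, map_sub]
    rw [add_right_comm]

lemma HasDiffDegree.linear_factor {k : ℕ} {h : Matrix (Fin n) (Fin n) F → Fin n → F}
    (hh : HasDiffDegree k h) (c : F) :
    HasDiffDegree (k + 1) fun X => (X - c • (1 : Matrix (Fin n) (Fin n) F)).mulVec (h X) := by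
  have leibniz : ∀ (h : Matrix (Fin n) (Fin n) F → Fin n → F) (δ : Matrix (Fin n) (Fin n) F),
      fwdDiff δ (fun X => (X - c • (1 : Matrix (Fin n) (Fin n) F)).mulVec (h X)) =
      (fun X => (X - c • (1 : Matrix (Fin n) (Fin n) F)).mulVec (fwdDiff δ h X)) +
        fun X => δ.mulVec (h (X + δ)) := by
    intro h δ
    funext X
    simp only [fwdDiff, Pi.add_apply, Matrix.mulVec_sub, add_sub_right_comm, Matrix.add_mulVec]
  induction k generalizing h with
  | zero =>
    intro δ
    rw [leibniz]
    intro x y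
    simp only [Pi.add_apply, fwdDiff, hh (x + δ) x, hh (y + δ) x, hh y x, sub_self,
      Matrix.mulVec_zero]
  | succ k ih =>
    intro δ
    rw [leibniz]
    exact (ih (hh δ)).add (hh.map_comp_shift (Matrix.mulVecLin δ).toAddMonoidHom δ)

/-- The vector `(X - c₁) ⋯ (X - c_k) v` for the list of scalars `c₁, …, c_k`. -/
def shiftProdVec (v : Fin n → F) (L : List F) (X : Matrix (Fin n) (Fin n) F) : Fin n → F :=
  (L.map fun c => X - c • (1 : Matrix (Fin n) (Fin n) F)).prod.mulVec v

lemma shiftProdVec_cons (v : Fin n → F) (c : F) (L : List F) :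
    shiftProdVec v (c :: L) =
      fun X => (X - c • (1 : Matrix (Fin n) (Fin n) F)).mulVec (shiftProdVec v L X) := by
  funext X
  simp [shiftProdVec, Matrix.mulVec_mulVec]

lemma hasDiffDegree_shiftProdVec (v : Fin n → F) (L : List F) :
    HasDiffDegree L.length (shiftProdVec v L) := by
  induction L with
  | nil => exact fun x y => by simp [shiftProdVec]
  | cons c L ih =>
    rw [shiftProdVec_cons]
    exact ih.linear_factor c

lemma iterDiff_linear_factor_row (l : List (Matrix (Fin n) (Fin n) F)) (i : Fin n)
    (hl : ∀ δ ∈ l, δ i = 0) (c : F) (h : Matrix (Fin n) (Fin n) F → Fin n → F)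
    (X : Matrix (Fin n) (Fin n) F) :
    iterDiff l (fun X => (X - c • (1 : Matrix (Fin n) (Fin n) F)).mulVec (h X)) X i =
      (X - c • (1 : Matrix (Fin n) (Fin n) F)).mulVec (iterDiff l h X) i := by
  induction l generalizing X with
  | nil => rfl
  | cons δ l ih =>
    have ih' := ih fun ε hε => hl ε (List.mem_cons_of_mem _ hε)
    have hδ : ∀ w, δ.mulVec w i = 0 := fun w => by
      simp [Matrix.mulVec, hl δ List.mem_cons_self]
    simp only [iterDiff, fwdDiff, Pi.sub_apply, ih', Matrix.mulVec_sub, add_sub_right_comm,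
      Matrix.add_mulVec, Pi.add_apply, hδ, add_zero]

/-- The rows of `M - N` in the block `t`, all other rows being zero. -/
def blockDiff {m : ℕ} (b : Fin n → Fin m) (M N : Matrix (Fin n) (Fin n) F) (t : Fin m) :
    Matrix (Fin n) (Fin n) F :=
  fun i => if b i = t then M i - N i else 0

/-- The matrix whose rows in the blocks selected by `S` come from `M`, the others from `N`. -/
def blockMix {m : ℕ} (b : Fin n → Fin m) (M N : Matrix (Fin n) (Fin n) F) (S : Fin m → Bool) :
    Matrix (Fin n) (Fin n) F :=
  fun i => if S (b i) then M i else N i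

/-- The difference of `shiftProdVec v L` along the blocks in the list `ts`. -/
def blockDiffVec {m : ℕ} (b : Fin n → Fin m) (v : Fin n → F) (N : Matrix (Fin n) (Fin n) F)
    (L : List F) (ts : List (Fin m)) (M : Matrix (Fin n) (Fin n) F) : Fin n → F :=
  iterDiff (ts.map (blockDiff b M N)) (shiftProdVec v L) 0

lemma blockDiffVec_cons_row {m : ℕ} (b : Fin n → Fin m) (v : Fin n → F)
    (N : Matrix (Fin n) (Fin n) F) (c : F) (L : List F) (ts : List (Fin m))
    (hlen : ts.length = L.length) (M : Matrix (Fin n) (Fin n) F) (i : Fin n) (hi : b i ∉ ts) :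
    blockDiffVec b v N (c :: L) (b i :: ts) M i =
      (M i - N i) ⬝ᵥ blockDiffVec b v N L ts M := by
  have hrow : ∀ δ ∈ ts.map (blockDiff b M N), δ i = 0 := by
    intro δ hδ
    obtain ⟨t, ht, rfl⟩ := List.mem_map.1 hδ
    have : b i ≠ t := fun h => hi (h ▸ ht)
    simp [blockDiff, this]
  have hconst := HasDiffDegree.iterDiff_const (ts.map (blockDiff b M N)) (shiftProdVec v L)
    (by simpa [hlen] using hasDiffDegree_shiftProdVec v L) (blockDiff b M N (b i)) 0
  simp only [blockDiffVec, List.map_cons, iterDiff, fwdDiff, Pi.sub_apply, shiftProdVec_cons,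
    iterDiff_linear_factor_row _ i hrow, zero_add, hconst]
  rw [← Pi.sub_apply, ← Matrix.sub_mulVec, sub_sub_sub_cancel_right, sub_zero]
  simp only [Matrix.mulVec, blockDiff, if_true]

lemma blockDiffVec_congr {m : ℕ} (b : Fin n → Fin m) (v : Fin n → F)
    (N : Matrix (Fin n) (Fin n) F) (L : List F) (ts : List (Fin m))
    (M M' : Matrix (Fin n) (Fin n) F) (h : ∀ i, b i ∈ ts → M i = M' i) :
    blockDiffVec b v N L ts M = blockDiffVec b v N L ts M' := by
  have : ts.map (blockDiff b M N) = ts.map (blockDiff b M' N) := by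
    refine List.map_congr_left fun t ht => ?_
    funext i
    simp only [blockDiff]
    split_ifs with hi
    · rw [h i (hi ▸ ht)]
    · rfl
  rw [blockDiffVec, this, blockDiffVec]

lemma iterDiff_blockDiff_eq_zero {m : ℕ} (b : Fin n → Fin m) (M N : Matrix (Fin n) (Fin n) F)
    (h : Matrix (Fin n) (Fin n) F → Fin n → F)
    (hh : ∀ S : Fin m → Bool, h (blockMix b M N S) = 0)
    (ts : List (Fin m)) (hts : ts.Nodup) (S : Fin m → Bool) (hS : ∀ t ∈ ts, S t = false) :
    iterDiff (ts.map (blockDiff b M N)) h (blockMix b M N S) = 0 := by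
  induction ts generalizing S with
  | nil => exact hh S
  | cons t ts ih =>
    obtain ⟨ht, hts⟩ := List.nodup_cons.1 hts
    have e : blockMix b M N S + blockDiff b M N t = blockMix b M N (Function.update S t true) := by
      ext i j
      by_cases hi : b i = t
      · simp [Matrix.add_apply, blockMix, blockDiff, hi, hS t List.mem_cons_self]
      · simp [Matrix.add_apply, blockMix, blockDiff, hi]
    simp only [List.map_cons, iterDiff, fwdDiff]
    rw [e, ih hts S fun s hs => hS s (List.mem_cons_of_mem _ hs), ih hts, sub_zero]
    intro s hs
    have : s ≠ t := fun h => ht (h ▸ hs)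
    simpa [this] using hS s (List.mem_cons_of_mem _ hs)

lemma blockDiffVec_eq_zero {m : ℕ} (b : Fin n → Fin m) (v : Fin n → F)
    (M N : Matrix (Fin n) (Fin n) F) (L : List F) (ts : List (Fin m)) (hts : ts.Nodup)
    (hlen : ts.length = L.length)
    (hh : ∀ S : Fin m → Bool, shiftProdVec v L (blockMix b M N S) = 0) :
    blockDiffVec b v N L ts M = 0 := by
  rw [← iterDiff_blockDiff_eq_zero b M N _ hh ts hts (fun _ => false) fun _ _ => rfl]
  exact HasDiffDegree.iterDiff_const _ _
    (by simpa [hlen] using hasDiffDegree_shiftProdVec v L) _ _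

end Differences

section Balanced

variable {F : Type*} [Field F] [Fintype F] {α : ℝ} {n : ℕ}

lemma IsBalanced.apply_le {μ : F → ℝ} (h : IsBalanced α μ) (x : F) : μ x ≤ 1 - α := by
  have := h.2.2 x ⊥ bot_ne_top
  simpa [sub_eq_zero, Finset.sum_filter] using this

lemma prodProb_dotProduct_eq_zero_le {μ : Fin n → F → ℝ} (hμ : ∀ j, IsBalanced α (μ j))
    (u w : Fin n → F) (hw : w ≠ 0) :
    prodProb μ {r | (r - u) ⬝ᵥ w = 0} ≤ 1 - α := by
  obtain ⟨j, hj⟩ := Function.ne_iff.1 hw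
  have hj : w j ≠ 0 := hj
  have h := prodProb_le_pow (fun i => (hμ i).1) (fun i => (hμ i).2.1) (β := 1 - α) {j}
    {r | (r - u) ⬝ᵥ w = 0}
    (fun _ r => {u j - (∑ k ∈ Finset.univ.erase j, (r k - u k) * w k) / w j})
    (by
      intro i _ x y hxy
      have : ∀ k ∈ Finset.univ.erase j, (x k - u k) * w k = (y k - u k) * w k := fun k hk => by
        rw [hxy k (by simpa using hk)]
      rw [Finset.sum_congr rfl this])
    (by
      intro i _ x
      simpa [Finset.sum_ite_eq'] using (hμ i).apply_le _)
    (by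
      intro x hx i hi
      obtain rfl := Finset.mem_singleton.1 hi
      have hx : ∑ k, (x k - u k) * w k = 0 := hx
      rw [← Finset.add_sum_erase _ _ (Finset.mem_univ i)] at hx
      rw [Set.mem_singleton_iff]
      field_simp
      linear_combination hx)
  simpa using h

lemma prodProb_blockDiffVec_eq_zero_le {m : ℕ} {μ : Fin n → Fin n → F → ℝ}
    (hμ : ∀ i j, IsBalanced α (μ i j)) (hα0 : 0 < α) (hα1 : α < 1) (b : Fin n → Fin m) (s : ℕ)
    (hb : ∀ t, s ≤ (Finset.univ.filter fun i => b i = t).card) (v : Fin n → F) (hv : v ≠ 0)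
    (N : Matrix (Fin n) (Fin n) F) (L : List F) (ts : List (Fin m)) (hts : ts.Nodup)
    (hlen : ts.length = L.length) :
    prodProb (fun i (r : Fin n → F) => ∏ j, μ i j (r j)) {M | blockDiffVec b v N L ts M = 0} ≤
      ts.length * (1 - α) ^ s := by
  have hp : ∀ i (r : Fin n → F), 0 ≤ ∏ j, μ i j (r j) := fun i r =>
    Finset.prod_nonneg fun j _ => (hμ i j).1 _
  have h1 : ∀ i, ∑ r : Fin n → F, ∏ j, μ i j (r j) = 1 := fun i =>
    sum_prod_weight_eq_one fun j => (hμ i j).2.1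
  induction ts generalizing L with
  | nil =>
    obtain rfl : L = [] := List.length_eq_zero_iff.1 hlen.symm
    simp [blockDiffVec, iterDiff, shiftProdVec, hv, prodProb]
  | cons t ts ih =>
    obtain ⟨ht, hts⟩ := List.nodup_cons.1 hts
    obtain _ | ⟨c, L⟩ := L
    · simp at hlen
    have hlen' : ts.length = L.length := by simpa using hlen
    let I : Finset (Fin n) := Finset.univ.filter fun i => b i = t
    have hind := prodProb_le_pow hp h1 (β := 1 - α) I
      {M | blockDiffVec b v N L ts M ≠ 0 ∧ blockDiffVec b v N (c :: L) (t :: ts) M = 0}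
      (fun i M => {r | blockDiffVec b v N L ts M ≠ 0 ∧
        (r - N i) ⬝ᵥ blockDiffVec b v N L ts M = 0})
      (by
        intro i _ M M' hM
        have : blockDiffVec b v N L ts M = blockDiffVec b v N L ts M' := by
          refine blockDiffVec_congr b v N L ts M M' fun k hk => hM k ?_
          simp only [I, Finset.mem_filter, Finset.mem_univ, true_and]
          rintro rfl
          exact ht hk
        rw [this])
      (by
        intro i _ M
        by_cases hw : blockDiffVec b v N L ts M = 0
        · simp [hw, hα1.le]
        · simpa [hw, prodProb] using prodProb_dotProduct_eq_zero_le (hμ i) (N i) _ hw)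
      (by
        rintro M ⟨hw, hM⟩ i hi
        have hi : b i = t := by simpa [I] using hi
        subst hi
        refine ⟨hw, ?_⟩
        rw [← blockDiffVec_cons_row b v N c L ts hlen' M i ht, hM, Pi.zero_apply])
    have hpow : (1 - α) ^ I.card ≤ (1 - α) ^ s :=
      pow_le_pow_of_le_one (by linarith) (by linarith) (hb t)
    have hsub : {M | blockDiffVec b v N (c :: L) (t :: ts) M = 0} ⊆
        {M | blockDiffVec b v N L ts M = 0} ∪
        {M | blockDiffVec b v N L ts M ≠ 0 ∧
          blockDiffVec b v N (c :: L) (t :: ts) M = 0} := by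
      intro M hM
      by_cases h : blockDiffVec b v N L ts M = 0
      · exact Or.inl h
      · exact Or.inr ⟨h, hM⟩
    have hunion := (prodProb_mono hp hsub).trans (prodProb_union_le hp _ _)
    have hprev := ih L hts hlen'
    refine hunion.trans ?_
    rw [List.length_cons, Nat.cast_succ, add_mul, one_mul]
    exact add_le_add hprev (hind.trans hpow)

end Balanced

lemma le_card_filter_mod {n m : ℕ} (hm : 0 < m) (t : Fin m) :
    n / m ≤ (Finset.univ.filter fun i : Fin n => (⟨i % m, Nat.mod_lt _ hm⟩ : Fin m) = t).card := by
  have hlt : ∀ s : Fin (n / m), t + m * s < n := fun s => by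
    have h1 : m * (s + 1) ≤ m * (n / m) := Nat.mul_le_mul_left _ s.2
    have h2 := Nat.mul_div_le n m
    have h3 := t.2
    rw [mul_add] at h1
    omega
  have := Finset.card_le_card_of_injOn (s := (Finset.univ : Finset (Fin (n / m))))
    (t := Finset.univ.filter fun i : Fin n => (⟨i % m, Nat.mod_lt _ hm⟩ : Fin m) = t)
    (fun s => ⟨t + m * s, hlt s⟩)
    (fun s _ => by simp [Fin.ext_iff, Nat.mod_eq_of_lt t.2])
    (fun s _ s' _ h => by
      have h : (t : ℕ) + m * s = t + m * s' := by simpa using h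
      exact Fin.ext (Nat.eq_of_mul_eq_mul_left hm (by omega)))
  simpa using this

theorem stmt19 (F : Type) [Field F] [Fintype F] (α : ℝ) (hα0 : 0 < α) (hα1 : α < 1)
    (n m : ℕ) (hm : 1 ≤ m) (hmn : m ≤ n) (lam : Fin m → F)
    (μ : Fin n → Fin n → F → ℝ) (hbal : ∀ i j, IsBalanced α (μ i j))
    (v : Fin n → F) (hv : v ≠ 0) :
    matProb μ {M : Matrix (Fin n) (Fin n) F |
        (List.ofFn fun j : Fin m =>
          (M - lam j • (1 : Matrix (Fin n) (Fin n) F))).prod.mulVec v = 0} ≤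
      ((m : ℝ) * (1 - α) ^ (n / m)) ^ ((1 : ℝ) / 2 ^ m) := by
  let p : Fin n → (Fin n → F) → ℝ := fun i r => ∏ j, μ i j (r j)
  have hp : ∀ i r, 0 ≤ p i r := fun i r => Finset.prod_nonneg fun j _ => (hbal i j).1 _
  have h1 : ∀ i, ∑ r, p i r = 1 := fun i => sum_prod_weight_eq_one fun j => (hbal i j).2.1
  let b : Fin n → Fin m := fun i => ⟨i % m, Nat.mod_lt _ hm⟩
  let L : List F := List.ofFn lam
  have hprob : matProb μ {M : Matrix (Fin n) (Fin n) F |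
      (List.ofFn fun j : Fin m =>
        (M - lam j • (1 : Matrix (Fin n) (Fin n) F))).prod.mulVec v = 0} =
      prodProb p {M | shiftProdVec v L M = 0} := by
    rw [matProb, Finset.sum_filter, prodProb]
    refine Finset.sum_congr rfl fun M _ => ?_
    simp only [Set.mem_ofPred_eq, shiftProdVec, L, List.map_ofFn, Function.comp_def, p]
    split_ifs with h h' h'
    · rfl
    · exact absurd h h'
    · exact absurd h' h
    · rfl
  rw [hprob]
  have hC : 0 ≤ prodProb p {M | shiftProdVec v L M = 0} := prodProb_nonneg hp _
  have hpow : prodProb p {M | shiftProdVec v L M = 0} ^ 2 ^ m ≤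
      (m : ℝ) * (1 - α) ^ (n / m) := by
    refine (prodProb_pow_le_decoupled_blocks hp h1 b _).trans ?_
    calc _ ≤ ∑ N : Fin n → Fin n → F, (∏ i, p i (N i)) * ((m : ℝ) * (1 - α) ^ (n / m)) := by
          refine Finset.sum_le_sum fun N _ => mul_le_mul_of_nonneg_left ?_
            (Finset.prod_nonneg fun i _ => hp _ _)
          have h := prodProb_blockDiffVec_eq_zero_le hbal hα0 hα1 b (n / m)
            (le_card_filter_mod hm) v hv N L (List.finRange m) (List.nodup_finRange m)
            (by simp [L])
          rw [List.length_finRange] at h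
          exact (prodProb_mono hp fun M hM => blockDiffVec_eq_zero b v M N L _
            (List.nodup_finRange m) (by simp [L]) hM).trans h
      _ = _ := by rw [← Finset.sum_mul, sum_prod_weight_eq_one h1, one_mul]
  have h := Real.rpow_le_rpow (pow_nonneg hC _) hpow (z := (1 : ℝ) / 2 ^ m) (by positivity)
  rwa [← Real.rpow_natCast, ← Real.rpow_mul hC, Nat.cast_pow, Nat.cast_ofNat,
    mul_one_div_cancel (by positivity), Real.rpow_one] at h
end
end
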